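/- arXiv:0801.2996 — 2 statements merged into one kernel-verified Lean document; each statement's English description precedes it below -/
import Mathlib

section
/- Let a > 0 and c > 0, and suppose z₀ = x₀ + iy₀ (x₀, y₀ real) satisfies F_{a,c}(z₀) = 0. Then ∫₀¹ [f_t(y₀ + c) − f_t(y₀ − c)] · [K_{ix₀}(a/√t)]² · (dt/t) = 0, where the integral converges absolutely. -/
open MeasureTheory Real Set

/-- Modified Bessel function of the third kind `K_w(a)` for `a > 0`:
`K_w(a) = ∫₀^∞ e^{−a·cosh u} · cosh(w·u) du`. -/
noncomputable def Kbes (a : ℝ) (w : ℂ) : ℂ :=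
  ∫ u in Ioi (0:ℝ), Complex.exp (-(a:ℂ) * (Real.cosh u : ℂ)) * Complex.cosh (w * (u:ℂ))

/-- `K_{iz}(a) = ∫₀^∞ e^{−a·cosh u} · cos(z·u) du`. -/
noncomputable def Kiz (a : ℝ) (z : ℂ) : ℂ :=
  ∫ u in Ioi (0:ℝ), Complex.exp (-(a:ℂ) * (Real.cosh u : ℂ)) * Complex.cos (z * (u:ℂ))

/-- The real-valued function `K_{ix}(a)` for real `x`. -/
noncomputable def Kre (a x : ℝ) : ℝ :=
  ∫ u in Ioi (0:ℝ), Real.exp (-a * Real.cosh u) * Real.cos (x * u)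

/-- The series `∑_{k=0}^∞ ((y+1)_k)² (1−t)^k / (k!·(k+1)!) = ₂F₁(y+1,y+1;2;1−t)`. -/
noncomputable def Sgauss (y t : ℝ) : ℝ :=
  ∑' k : ℕ, ((ascPochhammer ℝ k).eval (y + 1))^2 * (1 - t)^k /
    ((k.factorial : ℝ) * ((k+1).factorial : ℝ))

/-- `f_t(y) = y² · t^y · ₂F₁(y+1, y+1; 2; 1−t)`. -/
noncomputable def fPol (t y : ℝ) : ℝ := y^2 * t ^ y * Sgauss y t

/-- `F_{a,c}(z) = K_{i(z−ic)}(a) + K_{i(z+ic)}(a)`. -/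
noncomputable def Fac (a c : ℝ) (z : ℂ) : ℂ :=
  Kbes a (Complex.I * (z - Complex.I * (c:ℂ))) + Kbes a (Complex.I * (z + Complex.I * (c:ℂ)))

/-- Pólya's function `Ξ*(z) = 16π² ∫₀^∞ cosh(9u/2) e^{−2π cosh 2u} cos(zu) du`. -/
noncomputable def XiStar (z : ℂ) : ℂ :=
  16 * (Real.pi : ℂ)^2 * ∫ u in Ioi (0:ℝ),
    ((Real.cosh (9*u/2) * Real.exp (-(2*Real.pi) * Real.cosh (2*u)) : ℝ) : ℂ) *
      Complex.cos (z * (u:ℂ))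

/-- `S(α, β; w) = ∑_{k=0}^∞ (α)_k (β)_k w^k / (k!·(k+1)!) = ₂F₁(α, β; 2; w)`. -/
noncomputable def S2gauss (α β w : ℝ) : ℝ :=
  ∑' k : ℕ, (ascPochhammer ℝ k).eval α * (ascPochhammer ℝ k).eval β * w^k /
    ((k.factorial : ℝ) * ((k+1).factorial : ℝ))

/-- `g_{t,c}(y)`. -/
noncomputable def gPol (t c y : ℝ) : ℝ :=
  y*(y+2*c) * t ^ (y+c) * S2gauss (y+1) (y+2*c+1) (1-t)
  + y*(y-2*c) * t ^ (y-c) * S2gauss (y+1) (y-2*c+1) (1-t)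
  - 2*y^2 * t ^ y * S2gauss (y+1) (y+1) (1-t)

/-- The binomial series for `(1 - z) ^ (-y)`. -/
theorem hasSum_one_sub_cpow_neg (y : ℝ) {z : ℂ} (hz : ‖z‖ < 1) :
    HasSum (fun k : ℕ => (((ascPochhammer ℝ k).eval y / (k.factorial : ℝ) : ℝ) : ℂ) * z ^ k)
      ((1 - z) ^ (-(y : ℂ))) := by
  have h := (Complex.one_div_one_sub_cpow_hasFPowerSeriesOnBall_zero (y : ℂ)).hasSum
    (y := z) (by
      rw [Metric.mem_eball, edist_zero_right, ← ofReal_norm, ENNReal.ofReal_lt_one]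
      exact hz)
  rw [zero_add, one_div, ← Complex.cpow_neg] at h
  refine h.congr_fun fun k => ?_
  rw [FormalMultilinearSeries.ofScalars_apply_eq, smul_eq_mul]
  congr 1
  have h1 : Ring.choose ((y : ℂ) + k - 1) k = ((Ring.multichoose y k : ℝ) : ℂ) := by
    have hy : Ring.choose (y + k - 1) k = Ring.multichoose y k := by
      rw [Ring.choose]
      congr 1
      ring
    rw [← hy, Complex.ofReal_choose]
    push_cast
    rfl
  have h2 := Ring.factorial_nsmul_multichoose_eq_ascPochhammer y k
  rw [Polynomial.ascPochhammer_smeval_eq_eval, nsmul_eq_mul] at h2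
  rw [h1, ← h2, mul_div_cancel_left₀ _ (by positivity)]

/-- Orthogonality of the characters `θ ↦ e^{inθ}` on `[-π, π]`. -/
theorem integral_exp_int_mul_I (n : ℤ) :
    ∫ θ in (-π)..π, Complex.exp (n * θ * Complex.I) = if n = 0 then 2 * (π : ℂ) else 0 := by
  split_ifs with hn
  · subst hn
    simp only [Int.cast_zero, zero_mul, Complex.exp_zero, intervalIntegral.integral_const,
      sub_neg_eq_add, Complex.real_smul, mul_one]
    push_cast
    ring
  · have h := integral_exp_mul_complex (a := -π) (b := π) (c := n * Complex.I)
      (mul_ne_zero (by exact_mod_cast hn) Complex.I_ne_zero)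
    have he : Complex.exp (n * Complex.I * (π : ℝ)) = Complex.exp (n * Complex.I * (-π : ℝ)) := by
      rw [Complex.exp_eq_exp_iff_exists_int]
      refine ⟨n, ?_⟩
      push_cast
      ring
    rw [he, sub_self, zero_div] at h
    rw [← h]
    congr 1
    ext θ
    congr 1
    ring

/-- A Parseval type identity for the product of two absolutely convergent Fourier series. -/
theorem hasSum_integral_mul_exp {α β : ℕ → ℂ} (hα : Summable α) (hβ : Summable β) {f g : ℝ → ℂ}
    (hf : ∀ θ : ℝ, HasSum (fun j : ℕ => α j * Complex.exp (θ * Complex.I) ^ j) (f θ))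
    (hg : ∀ θ : ℝ, HasSum (fun k : ℕ => β k * Complex.exp (-(θ * Complex.I)) ^ k) (g θ)) :
    HasSum (fun j : ℕ => 2 * (π : ℂ) * (α j * β (j + 1)))
      (∫ θ in (-π)..π, f θ * g θ * Complex.exp (θ * Complex.I)) := by
  have hn1 : ∀ θ : ℝ, ‖Complex.exp (θ * Complex.I)‖ = 1 := Complex.norm_exp_ofReal_mul_I
  have hn2 : ∀ θ : ℝ, ‖Complex.exp (-(θ * Complex.I))‖ = 1 := fun θ => by
    rw [Complex.exp_neg, norm_inv, hn1, inv_one]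
  have hsum : Summable fun i : ℕ × ℕ => ‖α i.1‖ * ‖β i.2‖ :=
    hα.norm.mul_of_nonneg hβ.norm (fun _ => norm_nonneg _) fun _ => norm_nonneg _
  have hprod : ∀ θ : ℝ, HasSum (fun i : ℕ × ℕ => α i.1 * Complex.exp (θ * Complex.I) ^ i.1 *
      (β i.2 * Complex.exp (-(θ * Complex.I)) ^ i.2)) (f θ * g θ) := by
    intro θ
    have hs : Summable fun i : ℕ × ℕ => α i.1 * Complex.exp (θ * Complex.I) ^ i.1 *
        (β i.2 * Complex.exp (-(θ * Complex.I)) ^ i.2) := by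
      refine Summable.of_norm (hsum.congr fun i => ?_)
      rw [norm_mul, norm_mul, norm_mul, norm_pow, norm_pow, hn1, hn2, one_pow, one_pow, mul_one,
        mul_one]
    rw [← (hf θ).tsum_eq, ← (hg θ).tsum_eq, (hf θ).summable.tsum_mul_tsum (hg θ).summable hs]
    exact hs.hasSum
  have key := intervalIntegral.hasSum_integral_of_dominated_convergence (a := -π) (b := π)
    (μ := volume)
    (F := fun (i : ℕ × ℕ) (θ : ℝ) => α i.1 * Complex.exp (θ * Complex.I) ^ i.1 *
      (β i.2 * Complex.exp (-(θ * Complex.I)) ^ i.2) * Complex.exp (θ * Complex.I))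
    (f := fun θ => f θ * g θ * Complex.exp (θ * Complex.I))
    (fun i _ => ‖α i.1‖ * ‖β i.2‖)
    (fun i => (Continuous.aestronglyMeasurable (by fun_prop)))
    (fun i => Filter.Eventually.of_forall fun θ _ => by
      simp [hn1, hn2])
    (Filter.Eventually.of_forall fun θ _ => hsum)
    (by simp)
    (Filter.Eventually.of_forall fun θ _ => by
      exact (hprod θ).mul_right _)
  refine key.prod_fiberwise fun j => ?_
  have hintegral : ∀ k : ℕ, (∫ θ in (-π)..π, α j * Complex.exp (θ * Complex.I) ^ j *
      (β k * Complex.exp (-(θ * Complex.I)) ^ k) * Complex.exp (θ * Complex.I)) =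
      if k = j + 1 then 2 * (π : ℂ) * (α j * β (j + 1)) else 0 := by
    intro k
    have h1 : ∀ θ : ℝ, α j * Complex.exp (θ * Complex.I) ^ j *
      (β k * Complex.exp (-(θ * Complex.I)) ^ k) * Complex.exp (θ * Complex.I) =
      α j * β k * Complex.exp (((j + 1 - k : ℤ) : ℂ) * θ * Complex.I) := by
      intro θ
      have : ((j + 1 - k : ℤ) : ℂ) * θ * Complex.I =
        j * (θ * Complex.I) + k * (-(θ * Complex.I)) + θ * Complex.I := by
        push_cast
        ring
      rw [this, Complex.exp_add, Complex.exp_add, Complex.exp_nat_mul, Complex.exp_nat_mul]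
      ring
    simp_rw [h1]
    rw [intervalIntegral.integral_const_mul, integral_exp_int_mul_I]
    by_cases hk : k = j + 1
    · subst hk
      simp [mul_comm]
    · rw [if_neg hk, if_neg (by omega), mul_zero]
  simp only [hintegral]
  exact hasSum_ite_eq (j + 1) _

theorem ascPochhammer_eval_succ_left (k : ℕ) (y : ℝ) :
    (ascPochhammer ℝ (k + 1)).eval y = y * (ascPochhammer ℝ k).eval (y + 1) := by
  rw [ascPochhammer_succ_left]
  simp [Polynomial.eval_comp]

theorem one_sub_two_mul_cos_add_sq_pos {r : ℝ} (hr : |r| < 1) (θ : ℝ) :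
    0 < 1 - 2 * r * cos θ + r ^ 2 := by
  have h1 : |r * cos θ| ≤ |r| := by
    rw [abs_mul]
    exact mul_le_of_le_one_right (abs_nonneg r) (abs_cos_le_one θ)
  have h2 := le_abs_self (r * cos θ)
  nlinarith [sq_abs r, abs_nonneg r, sq_nonneg (1 - |r|)]

/-- The Gauss series `₂F₁(y+1, y+1; 2; r²)` as a trigonometric integral. -/
theorem integral_rpow_mul_cos_sub_eq_Sgauss (y : ℝ) {r : ℝ} (hr0 : 0 < r) (hr1 : r < 1) :
    ∫ θ in (-π)..π, (1 - 2 * r * cos θ + r ^ 2) ^ (-y - 1) * (cos θ - r) =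
      2 * π * r * (y * Sgauss y (1 - r ^ 2)) := by
  have hrabs : |r| < 1 := by rwa [abs_of_pos hr0]
  have hn1 : ∀ θ : ℝ, ‖(r : ℂ) * Complex.exp (θ * Complex.I)‖ < 1 := fun θ => by
    rw [norm_mul, Complex.norm_exp_ofReal_mul_I, mul_one, Complex.norm_real]
    exact hrabs
  have hn2 : ∀ θ : ℝ, ‖(r : ℂ) * Complex.exp (-(θ * Complex.I))‖ < 1 := fun θ => by
    have := hn1 (-θ)
    rwa [Complex.ofReal_neg, neg_mul] at this
  have hrn : ‖(r : ℂ)‖ < 1 := by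
    rw [Complex.norm_real]
    exact hrabs
  have key := hasSum_integral_mul_exp
    (hasSum_one_sub_cpow_neg (y + 1) hrn).summable (hasSum_one_sub_cpow_neg y hrn).summable
    (f := fun θ => (1 - (r : ℂ) * Complex.exp (θ * Complex.I)) ^ (-((y + 1 : ℝ) : ℂ)))
    (g := fun θ => (1 - (r : ℂ) * Complex.exp (-(θ * Complex.I))) ^ (-(y : ℂ)))
    (fun θ => (hasSum_one_sub_cpow_neg (y + 1) (hn1 θ)).congr_fun fun k => by
      rw [mul_pow, mul_assoc])
    (fun θ => (hasSum_one_sub_cpow_neg y (hn2 θ)).congr_fun fun k => by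
      rw [mul_pow, mul_assoc])
  have hfun : ∀ θ : ℝ, (1 - (r : ℂ) * Complex.exp (θ * Complex.I)) ^ (-((y + 1 : ℝ) : ℂ)) *
      (1 - (r : ℂ) * Complex.exp (-(θ * Complex.I))) ^ (-(y : ℂ)) * Complex.exp (θ * Complex.I) =
      (((1 - 2 * r * cos θ + r ^ 2) ^ (-y - 1) : ℝ) : ℂ) * (Complex.exp (θ * Complex.I) - r) := by
    intro θ
    set w : ℂ := 1 - (r : ℂ) * Complex.exp (θ * Complex.I) with hw
    have hD := one_sub_two_mul_cos_add_sq_pos hrabs θ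
    have hconj : (starRingEnd ℂ) w = 1 - (r : ℂ) * Complex.exp (-(θ * Complex.I)) := by
      rw [hw, map_sub, map_one, map_mul, Complex.conj_ofReal, ← Complex.exp_conj, map_mul,
        Complex.conj_ofReal, Complex.conj_I, mul_neg]
    have hnsq : Complex.normSq w = 1 - 2 * r * cos θ + r ^ 2 := by
      rw [hw, Complex.normSq_apply, Complex.sub_re, Complex.sub_im, Complex.re_ofReal_mul,
        Complex.im_ofReal_mul, Complex.exp_ofReal_mul_I_re, Complex.exp_ofReal_mul_I_im,
        Complex.one_re, Complex.one_im]
      linear_combination r ^ 2 * sin_sq_add_cos_sq θ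
    have hw0 : w ≠ 0 := by
      rw [← Complex.normSq_pos, hnsq]
      exact hD
    have harg : w.arg ≠ π := by
      have : w ∈ Complex.slitPlane := by
        left
        rw [hw, Complex.sub_re, Complex.one_re]
        have := (Complex.abs_re_le_norm _).trans_lt (hn1 θ)
        linarith [le_abs_self ((r : ℂ) * Complex.exp (θ * Complex.I)).re]
      exact (Complex.mem_slitPlane_iff_arg.mp this).1
    have hg : (1 - (r : ℂ) * Complex.exp (-(θ * Complex.I))) ^ (-(y : ℂ)) =
        (starRingEnd ℂ) (w ^ (-(y : ℂ))) := by
      rw [← hconj, Complex.conj_cpow _ _ harg, map_neg, Complex.conj_ofReal]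
    have hprod : w ^ (-(y : ℂ)) * (starRingEnd ℂ) (w ^ (-(y : ℂ))) =
        (((1 - 2 * r * cos θ + r ^ 2) ^ (-y) : ℝ) : ℂ) := by
      rw [Complex.mul_conj, Complex.normSq_eq_norm_sq, ← Complex.ofReal_neg,
        Complex.norm_cpow_real, ← Real.rpow_natCast, ← Real.rpow_mul (norm_nonneg _),
        mul_comm (-y), Real.rpow_mul (norm_nonneg _), Real.rpow_natCast,
        ← Complex.normSq_eq_norm_sq, hnsq]
    have hsplit : w ^ (-((y + 1 : ℝ) : ℂ)) = w ^ (-(y : ℂ)) * w⁻¹ := by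
      rw [Complex.ofReal_add, neg_add, Complex.cpow_add _ _ hw0, Complex.ofReal_one,
        Complex.cpow_neg_one]
    have hexp : Complex.exp (-(θ * Complex.I)) * Complex.exp (θ * Complex.I) = 1 := by
      rw [← Complex.exp_add, neg_add_cancel, Complex.exp_zero]
    rw [hg, hsplit, mul_right_comm (w ^ (-(y : ℂ))), hprod, Complex.inv_def, hnsq, hconj,
      Real.rpow_sub_one hD.ne']
    push_cast
    linear_combination (-(((1 - 2 * r * cos θ + r ^ 2) ^ (-y) : ℝ) : ℂ) *
      (1 - 2 * r * Complex.cos θ + r ^ 2 : ℂ)⁻¹ * r) * hexp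
  simp only [hfun] at key
  have hcont : Continuous fun θ : ℝ => (((1 - 2 * r * cos θ + r ^ 2) ^ (-y - 1) : ℝ) : ℂ) *
      (Complex.exp (θ * Complex.I) - r) := by
    refine (Complex.continuous_ofReal.comp ?_).mul (by fun_prop)
    exact Continuous.rpow_const (by fun_prop)
      fun θ => Or.inl (one_sub_two_mul_cos_add_sq_pos hrabs θ).ne'
  have hre := Complex.reCLM.hasSum key
  have hcomm := Complex.reCLM.intervalIntegral_comp_comm (hcont.intervalIntegrable (-π) π)
    (μ := volume)
  rw [← hcomm] at hre
  have hintegral : ∀ θ : ℝ, Complex.reCLM ((((1 - 2 * r * cos θ + r ^ 2) ^ (-y - 1) : ℝ) : ℂ) *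
      (Complex.exp (θ * Complex.I) - r)) =
      (1 - 2 * r * cos θ + r ^ 2) ^ (-y - 1) * (cos θ - r) := by
    intro θ
    rw [Complex.reCLM_apply, Complex.re_ofReal_mul, Complex.sub_re, Complex.exp_ofReal_mul_I_re,
      Complex.ofReal_re]
  simp only [hintegral] at hre
  rw [← hre.tsum_eq, Sgauss, ← tsum_mul_left, ← tsum_mul_left]
  congr 1
  ext k
  have : Complex.reCLM (2 * (π : ℂ) *
      (((((ascPochhammer ℝ k).eval (y + 1) / (k.factorial : ℝ) : ℝ) : ℂ) * (r : ℂ) ^ k) *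
      ((((ascPochhammer ℝ (k + 1)).eval y / ((k + 1).factorial : ℝ) : ℝ) : ℂ) *
        (r : ℂ) ^ (k + 1)))) =
      2 * π * (((ascPochhammer ℝ k).eval (y + 1) / (k.factorial : ℝ) * r ^ k) *
        ((ascPochhammer ℝ (k + 1)).eval y / ((k + 1).factorial : ℝ) * r ^ (k + 1))) := by
    rw [Complex.reCLM_apply, ← Complex.ofReal_re (2 * π * _)]
    push_cast
    rfl
  rw [this, ascPochhammer_eval_succ_left, sub_sub_cancel, ← pow_mul]
  field_simp
  ring

theorem integral_symm_eq_two_mul {f : ℝ → ℝ} (hf : Continuous f) (he : ∀ x, f (-x) = f x) (b : ℝ) :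
    ∫ x in (-b)..b, f x = 2 * ∫ x in (0:ℝ)..b, f x := by
  rw [← intervalIntegral.integral_add_adjacent_intervals (hf.intervalIntegrable (-b) 0)
    (hf.intervalIntegrable 0 b)]
  have h := intervalIntegral.integral_comp_neg (a := 0) (b := b) f
  simp only [he, neg_zero] at h
  rw [← h]
  ring

theorem cosh_two_mul_sub_sinh_two_mul_cos_pos (V θ : ℝ) :
    0 < cosh (2 * V) - sinh (2 * V) * cos θ := by
  have h1 := cosh_sq (2 * V)
  have h2 := cosh_pos (2 * V)
  have h3 : sinh (2 * V) * cos θ ≤ |sinh (2 * V)| :=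
    (le_abs_self _).trans (by
      rw [abs_mul]
      exact mul_le_of_le_one_right (abs_nonneg _) (abs_cos_le_one θ))
  have h4 : |sinh (2 * V)| < cosh (2 * V) := abs_lt_of_sq_lt_sq (by linarith) h2.le
  linarith

/-- The substitution `e^{2v} = cosh 2V - sinh 2V cos θ` in an Abel type integral. -/
theorem integral_exp_mul_sinh_div_sqrt (y : ℝ) {V : ℝ} (hV : 0 < V) :
    IntegrableOn (fun v => exp (-2 * y * v) * sinh v / √(sinh V ^ 2 - sinh v ^ 2)) (Ioo (-V) V) ∧
    ∫ v in Ioo (-V) V, exp (-2 * y * v) * sinh v / √(sinh V ^ 2 - sinh v ^ 2) =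
      ∫ θ in Ioo 0 π, (cosh (2 * V) - sinh (2 * V) * cos θ) ^ (-y - 1) *
        ((cosh (2 * V) - sinh (2 * V) * cos θ - 1) / 2) := by
  set E : ℝ → ℝ := fun θ => cosh (2 * V) - sinh (2 * V) * cos θ with hE
  have hEpos : ∀ θ, 0 < E θ := cosh_two_mul_sub_sinh_two_mul_cos_pos V
  set φ : ℝ → ℝ := fun θ => log (E θ) / 2 with hφ
  have hEderiv : ∀ θ, HasDerivAt E (sinh (2 * V) * sin θ) θ := fun θ => by
    have := ((hasDerivAt_cos θ).const_mul (sinh (2 * V))).const_sub (cosh (2 * V))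
    simpa using this
  have hderiv : ∀ θ, HasDerivAt φ (sinh (2 * V) * sin θ / E θ / 2) θ := fun θ =>
    ((hEderiv θ).log (hEpos θ).ne').div_const 2
  have hsinh : 0 < sinh (2 * V) := sinh_pos_iff.mpr (by linarith)
  have hcont : Continuous φ := continuous_iff_continuousAt.mpr fun θ => (hderiv θ).continuousAt
  have hmono : StrictMonoOn φ (Icc 0 π) := by
    refine strictMonoOn_of_deriv_pos (convex_Icc 0 π) hcont.continuousOn fun θ hθ => ?_
    rw [interior_Icc] at hθ
    rw [(hderiv θ).deriv]
    have := sin_pos_of_mem_Ioo hθ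
    have := hEpos θ
    positivity
  have hφ0 : φ 0 = -V := by
    have : E 0 = exp (-(2 * V)) := by
      simp only [hE, cos_zero, mul_one, cosh_sub_sinh]
    simp only [hφ, this, log_exp]
    ring
  have hφπ : φ π = V := by
    have : E π = exp (2 * V) := by
      simp only [hE, cos_pi, mul_neg, mul_one, sub_neg_eq_add, cosh_add_sinh]
    simp only [hφ, this, log_exp]
    ring
  have himage : φ '' Ioo 0 π = Ioo (-V) V := by
    refine Subset.antisymm ?_ ?_
    · rintro _ ⟨θ, hθ, rfl⟩
      rw [← hφ0, ← hφπ]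
      exact ⟨hmono (left_mem_Icc.mpr pi_pos.le) (Ioo_subset_Icc_self hθ) hθ.1,
        hmono (Ioo_subset_Icc_self hθ) (right_mem_Icc.mpr pi_pos.le) hθ.2⟩
    · have := intermediate_value_Ioo pi_pos.le hcont.continuousOn
      rwa [hφ0, hφπ] at this
  have hinj : InjOn φ (Ioo 0 π) := (hmono.mono Ioo_subset_Icc_self).injOn
  have heq : ∀ θ ∈ Ioo 0 π, |sinh (2 * V) * sin θ / E θ / 2| •
      (exp (-2 * y * φ θ) * sinh (φ θ) / √(sinh V ^ 2 - sinh (φ θ) ^ 2)) =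
      E θ ^ (-y - 1) * ((E θ - 1) / 2) := by
    intro θ hθ
    have hs := sin_pos_of_mem_Ioo hθ
    have hEp := hEpos θ
    set e : ℝ := exp (φ θ) with he
    have hepos : 0 < e := exp_pos _
    have hesq : E θ = e ^ 2 := by
      rw [he, ← exp_nat_mul]
      simp only [hφ]
      rw [Nat.cast_ofNat, mul_div_cancel₀ _ two_ne_zero, exp_log hEp]
    have hsφ : sinh (φ θ) = (e - e⁻¹) / 2 := by
      rw [sinh_eq, exp_neg]
    have hpow : exp (-2 * y * φ θ) = E θ ^ (-y) := by
      rw [rpow_def_of_pos hEp]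
      simp only [hφ]
      congr 1
      ring
    have hEdef : sinh (2 * V) * cos θ = cosh (2 * V) - e ^ 2 := by
      rw [← hesq]
      simp only [hE]
      ring
    have hroot : √(sinh V ^ 2 - sinh (φ θ) ^ 2) = sinh (2 * V) * sin θ / (2 * e) := by
      rw [sqrt_eq_iff_mul_self_eq_of_pos (by positivity)]
      have h1 := cosh_sq (2 * V)
      have h2 := sin_sq_add_cos_sq θ
      have h3 := cosh_two_mul V
      have h4 := cosh_sq V
      have h5 : (sinh (2 * V) * sin θ) ^ 2 = sinh (2 * V) ^ 2 - (cosh (2 * V) - e ^ 2) ^ 2 := by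
        rw [← hEdef]
        linear_combination sinh (2 * V) ^ 2 * h2
      have h6 : sinh V ^ 2 = (cosh (2 * V) - 1) / 2 := by linarith
      rw [hsφ, h6]
      field_simp
      linear_combination h5 - h1
    rw [hroot, hpow, hsφ, smul_eq_mul, abs_of_pos (by positivity), rpow_sub_one hEp.ne', hesq]
    field_simp
  have hc : Continuous fun θ => E θ ^ (-y - 1) * ((E θ - 1) / 2) := by
    have hEc : Continuous E := by fun_prop
    exact (hEc.rpow_const fun θ => Or.inl (hEpos θ).ne').mul (by fun_prop)
  have hI : IntegrableOn (fun θ => E θ ^ (-y - 1) * ((E θ - 1) / 2)) (Ioo 0 π) :=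
    (hc.integrableOn_Icc (a := 0) (b := π)).mono_set Ioo_subset_Icc_self
  constructor
  · rw [← himage, integrableOn_image_iff_integrableOn_abs_deriv_smul measurableSet_Ioo
      (fun θ _ => (hderiv θ).hasDerivWithinAt) hinj]
    exact hI.congr_fun (fun θ hθ => (heq θ hθ).symm) measurableSet_Ioo
  · rw [← himage, integral_image_eq_integral_abs_deriv_smul measurableSet_Ioo
      (fun θ _ => (hderiv θ).hasDerivWithinAt) hinj]
    exact setIntegral_congr_fun measurableSet_Ioo heq

/-- Folding the Abel type integral over `(-V, V)` onto `(0, V)`. -/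
theorem integral_sinh_mul_sinh_div_sqrt (y : ℝ) {V : ℝ} (hV : 0 < V) :
    IntegrableOn (fun v => 2 * sinh (2 * y * v) * sinh v / √(sinh V ^ 2 - sinh v ^ 2)) (Ioo 0 V) ∧
    ∫ v in Ioo 0 V, 2 * sinh (2 * y * v) * sinh v / √(sinh V ^ 2 - sinh v ^ 2) =
      -∫ v in Ioo (-V) V, exp (-2 * y * v) * sinh v / √(sinh V ^ 2 - sinh v ^ 2) := by
  obtain ⟨hI, -⟩ := integral_exp_mul_sinh_div_sqrt y hV
  set Ψ : ℝ → ℝ := fun v => exp (-2 * y * v) * sinh v / √(sinh V ^ 2 - sinh v ^ 2) with hΨ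
  have hII : IntervalIntegrable Ψ volume (-V) V := by
    rw [intervalIntegrable_iff_integrableOn_Ioo_of_le (by linarith)]
    exact hI
  have h1 : IntervalIntegrable Ψ volume (-V) 0 :=
    hII.mono_set (by
      rw [uIcc_of_le (by linarith), uIcc_of_le (by linarith)]
      exact Icc_subset_Icc le_rfl hV.le)
  have h2 : IntervalIntegrable Ψ volume 0 V :=
    hII.mono_set (by
      rw [uIcc_of_le (by linarith), uIcc_of_le (by linarith)]
      exact Icc_subset_Icc (by linarith) le_rfl)
  have h3 : IntervalIntegrable (fun v => Ψ (-v)) volume 0 V := by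
    have := (IntervalIntegrable.iff_comp_neg (f := Ψ) (a := -V) (b := 0)).mp h1
    simpa using this.symm
  have hfun : (fun v => 2 * sinh (2 * y * v) * sinh v / √(sinh V ^ 2 - sinh v ^ 2)) =
      fun v => -(Ψ (-v) + Ψ v) := by
    ext v
    simp only [hΨ, sinh_neg, neg_sq]
    rw [sinh_eq (2 * y * v)]
    have e1 : -2 * y * -v = 2 * y * v := by ring
    have e2 : -2 * y * v = -(2 * y * v) := by ring
    rw [e1, e2]
    ring
  rw [hfun]
  constructor
  · exact (intervalIntegrable_iff_integrableOn_Ioo_of_le hV.le).mp (h3.add h2).neg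
  · rw [← integral_Ioc_eq_integral_Ioo, ← integral_Ioc_eq_integral_Ioo,
      ← intervalIntegral.integral_of_le hV.le, ← intervalIntegral.integral_of_le (by linarith),
      intervalIntegral.integral_neg, intervalIntegral.integral_add h3 h2,
      intervalIntegral.integral_comp_neg, neg_zero,
      intervalIntegral.integral_add_adjacent_intervals h1 h2]

/-- `f_t(y)` at `t = 1 / cosh² V` as an Abel type integral. -/
theorem fPol_one_div_cosh_sq (y : ℝ) {V : ℝ} (hV : 0 < V) :
    fPol (1 / cosh V ^ 2) y = y * cosh V ^ 2 / (π * sinh V ^ 2) *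
      ∫ v in Ioo 0 V, 2 * sinh (2 * y * v) * sinh v / √(sinh V ^ 2 - sinh v ^ 2) := by
  have hs : 0 < sinh V := sinh_pos_iff.mpr hV
  have hc : 0 < cosh V := cosh_pos V
  have hsq := cosh_sq V
  set r : ℝ := sinh V / cosh V with hr
  have hr0 : 0 < r := by positivity
  have hr1 : r < 1 := by
    rw [hr, div_lt_one hc]
    exact sinh_lt_cosh V
  have ht : 1 - r ^ 2 = 1 / cosh V ^ 2 := by
    rw [hr]
    field_simp
    linarith
  have hmain := integral_rpow_mul_cos_sub_eq_Sgauss y hr0 hr1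
  have hcont : Continuous fun θ => (1 - 2 * r * cos θ + r ^ 2) ^ (-y - 1) * (cos θ - r) := by
    refine Continuous.mul (Continuous.rpow_const (by fun_prop) fun θ => Or.inl ?_) (by fun_prop)
    exact (one_sub_two_mul_cos_add_sq_pos (by rwa [abs_of_pos hr0]) θ).ne'
  rw [integral_symm_eq_two_mul hcont (fun θ => by rw [cos_neg]), ht] at hmain
  have hfun : ∀ θ, (1 - 2 * r * cos θ + r ^ 2) ^ (-y - 1) * (cos θ - r) =
      -((1 / cosh V ^ 2) ^ (-y - 1) / (sinh V * cosh V)) *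
      ((cosh (2 * V) - sinh (2 * V) * cos θ) ^ (-y - 1) *
        ((cosh (2 * V) - sinh (2 * V) * cos θ - 1) / 2)) := by
    intro θ
    have hD : 1 - 2 * r * cos θ + r ^ 2 =
        1 / cosh V ^ 2 * (cosh (2 * V) - sinh (2 * V) * cos θ) := by
      rw [hr, cosh_two_mul, sinh_two_mul]
      field_simp
      ring
    rw [hD, mul_rpow (by positivity) (cosh_two_mul_sub_sinh_two_mul_cos_pos V θ).le, cosh_two_mul V,
      sinh_two_mul V]
    have : cos θ - r = -(1 / (sinh V * cosh V)) *
        ((cosh V ^ 2 + sinh V ^ 2 - 2 * sinh V * cosh V * cos θ - 1) / 2) := by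
      rw [hr]
      field_simp
      linear_combination hsq
    rw [this]
    ring
  simp only [hfun] at hmain
  rw [intervalIntegral.integral_const_mul, intervalIntegral.integral_of_le pi_pos.le,
    integral_Ioc_eq_integral_Ioo, ← (integral_exp_mul_sinh_div_sqrt y hV).2] at hmain
  rw [(integral_sinh_mul_sinh_div_sqrt y hV).2, fPol]
  set I := ∫ v in Ioo (-V) V, exp (-2 * y * v) * sinh v / √(sinh V ^ 2 - sinh v ^ 2)
  have hpow : (1 / cosh V ^ 2) ^ y * (1 / cosh V ^ 2) ^ (-y - 1) = cosh V ^ 2 := by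
    rw [← rpow_add (by positivity), show y + (-y - 1) = -1 by ring, rpow_neg_one]
    simp
  have hyS : y * Sgauss y (1 / cosh V ^ 2) =
      -((1 / cosh V ^ 2) ^ (-y - 1) / (sinh V * cosh V)) * I / (π * r) := by
    rw [eq_div_iff (by positivity)]
    linarith
  have : y ^ 2 * (1 / cosh V ^ 2) ^ y * Sgauss y (1 / cosh V ^ 2) =
      y * (1 / cosh V ^ 2) ^ y * (y * Sgauss y (1 / cosh V ^ 2)) := by ring
  rw [this, hyS, show y * (1 / cosh V ^ 2) ^ y *
    (-((1 / cosh V ^ 2) ^ (-y - 1) / (sinh V * cosh V)) * I / (π * r)) =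
    -(y * ((1 / cosh V ^ 2) ^ y * (1 / cosh V ^ 2) ^ (-y - 1)) / (sinh V * cosh V) * I / (π * r))
    by ring, hpow, hr]
  field_simp

theorem fPol_nonneg {t : ℝ} (ht : t ∈ Ioo (0 : ℝ) 1) (y : ℝ) : 0 ≤ fPol t y := by
  obtain ⟨h0, h1⟩ := ht
  have h2 : 0 ≤ 1 - t := by linarith
  exact mul_nonneg (by positivity) (tsum_nonneg fun k => by positivity)

/-- The Beta type integral `∫ dQ / (Q √((Q - A) (B - Q))) = π / √(A B)` over `(A, B)`, in the
variable `Q = sinh² V`. -/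
theorem lintegral_coth_div_sqrt_mul_sqrt {v s : ℝ} (hv : 0 < v) (hvs : v < s) :
    ∫⁻ V in Ioo v s, ENNReal.ofReal (2 * cosh V / sinh V /
      (√(sinh V ^ 2 - sinh v ^ 2) * √(sinh s ^ 2 - sinh V ^ 2))) =
      ENNReal.ofReal (π / (sinh v * sinh s)) := by
  set A := sinh v with hA
  set B := sinh s with hB
  have hA0 : 0 < A := sinh_pos_iff.mpr hv
  have hAB : A < B := sinh_lt_sinh.mpr hvs
  have hB0 : 0 < B := hA0.trans hAB
  have hBA : 0 < B ^ 2 - A ^ 2 := by nlinarith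
  set T : ℝ → ℝ := fun V =>
    arcsin ((A ^ 2 + B ^ 2 - 2 * A ^ 2 * B ^ 2 / sinh V ^ 2) / (B ^ 2 - A ^ 2)) / (A * B) with hT
  have hpos : ∀ V ∈ Icc v s, 0 < sinh V := fun V hV => sinh_pos_iff.mpr (hv.trans_le hV.1)
  have hcont : ContinuousOn T (Icc v s) := by
    refine ContinuousOn.div_const (continuous_arcsin.comp_continuousOn ?_) _
    refine ContinuousOn.div_const (ContinuousOn.sub continuousOn_const ?_) _
    exact ContinuousOn.div continuousOn_const (by fun_prop) fun V hV => (pow_pos (hpos V hV) 2).ne'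
  have hderiv : ∀ V ∈ Ioo v s, HasDerivAt T (2 * cosh V / sinh V /
      (√(sinh V ^ 2 - A ^ 2) * √(B ^ 2 - sinh V ^ 2))) V := by
    intro V hV
    have hS := hpos V (Ioo_subset_Icc_self hV)
    have hAS : A < sinh V := sinh_lt_sinh.mpr hV.1
    have hSB : sinh V < B := sinh_lt_sinh.mpr hV.2
    have h1 : 0 < sinh V ^ 2 - A ^ 2 := by nlinarith
    have h2 : 0 < B ^ 2 - sinh V ^ 2 := by nlinarith
    set X := (A ^ 2 + B ^ 2 - 2 * A ^ 2 * B ^ 2 / sinh V ^ 2) / (B ^ 2 - A ^ 2) with hX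
    have hd : HasDerivAt (fun V => (A ^ 2 + B ^ 2 - 2 * A ^ 2 * B ^ 2 / sinh V ^ 2) /
        (B ^ 2 - A ^ 2)) (4 * A ^ 2 * B ^ 2 * cosh V / sinh V ^ 3 / (B ^ 2 - A ^ 2)) V := by
      have h := ((((hasDerivAt_sinh V).pow 2).inv (pow_pos hS 2).ne').const_mul
        (2 * A ^ 2 * B ^ 2)).const_sub (A ^ 2 + B ^ 2) |>.div_const (B ^ 2 - A ^ 2)
      refine h.congr_deriv ?_
      simp only [Pi.pow_apply]
      field_simp
      ring
    have hX2 : 1 - X ^ 2 = (2 * A * B * (√(sinh V ^ 2 - A ^ 2) * √(B ^ 2 - sinh V ^ 2)) /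
        (sinh V ^ 2 * (B ^ 2 - A ^ 2))) ^ 2 := by
      have : (2 * A * B * (√(sinh V ^ 2 - A ^ 2) * √(B ^ 2 - sinh V ^ 2)) /
          (sinh V ^ 2 * (B ^ 2 - A ^ 2))) ^ 2 = 4 * A ^ 2 * B ^ 2 *
          ((sinh V ^ 2 - A ^ 2) * (B ^ 2 - sinh V ^ 2)) /
          (sinh V ^ 2 * (B ^ 2 - A ^ 2)) ^ 2 := by
        rw [div_pow, mul_pow, mul_pow (√_), sq_sqrt h1.le, sq_sqrt h2.le]
        ring
      rw [this, hX]
      field_simp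
      ring
    have hXpos : 0 < 1 - X ^ 2 := by
      rw [hX2]
      have := sqrt_pos.mpr h1
      have := sqrt_pos.mpr h2
      positivity
    have hne1 : X ≠ -1 := by
      intro h
      rw [h] at hXpos
      norm_num at hXpos
    have hne2 : X ≠ 1 := by
      intro h
      rw [h] at hXpos
      norm_num at hXpos
    have := ((hasDerivAt_arcsin hne1 hne2).comp V hd).div_const (A * B)
    refine this.congr_deriv ?_
    have := sqrt_pos.mpr h1
    have := sqrt_pos.mpr h2
    rw [hX2, sqrt_sq (by positivity)]
    field_simp
    ring
  have hnn : ∀ V ∈ Ioo v s, 0 ≤ 2 * cosh V / sinh V /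
      (√(sinh V ^ 2 - A ^ 2) * √(B ^ 2 - sinh V ^ 2)) := by
    intro V hV
    have := hpos V (Ioo_subset_Icc_self hV)
    have := cosh_pos V
    positivity
  have hintegral := intervalIntegral.integrableOn_deriv_of_nonneg hcont hderiv hnn
  have hval := intervalIntegral.integral_eq_sub_of_hasDerivAt_of_le hvs.le hcont hderiv
    ((intervalIntegrable_iff_integrableOn_Ioc_of_le hvs.le).mpr hintegral)
  rw [intervalIntegral.integral_of_le hvs.le, integral_Ioc_eq_integral_Ioo] at hval
  rw [← ofReal_integral_eq_lintegral_ofReal (hintegral.mono_set Ioo_subset_Ioc_self)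
    ((ae_restrict_iff' measurableSet_Ioo).mpr (Filter.Eventually.of_forall hnn)), hval]
  congr 1
  have hTs : T s = π / 2 / (A * B) := by
    simp only [hT]
    rw [← hB, show (A ^ 2 + B ^ 2 - 2 * A ^ 2 * B ^ 2 / B ^ 2) / (B ^ 2 - A ^ 2) = 1 by
      field_simp; ring, arcsin_one]
  have hTv : T v = -(π / 2) / (A * B) := by
    simp only [hT]
    rw [← hA, show (A ^ 2 + B ^ 2 - 2 * A ^ 2 * B ^ 2 / A ^ 2) / (B ^ 2 - A ^ 2) = -1 by
      field_simp; ring, arcsin_neg_one]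
  rw [hTs, hTv]
  ring

theorem lintegral_exp_neg_mul_cosh_mul_cosh (β : ℝ) {V : ℝ} (hV : 0 < V) :
    ∫⁻ p in Ioi (0 : ℝ), ENNReal.ofReal (exp (-β * (cosh V * cosh p))) =
      ∫⁻ s in Ioi V, ENNReal.ofReal (exp (-β * cosh s) * sinh s / √(sinh s ^ 2 - sinh V ^ 2)) := by
  have hcV : 1 < cosh V := one_lt_cosh.mpr hV.ne'
  have hlt : ∀ p ∈ Ioi (0 : ℝ), cosh V < cosh V * cosh p := fun p hp => by
    have : 1 < cosh p := one_lt_cosh.mpr (ne_of_gt hp)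
    nlinarith
  set φ : ℝ → ℝ := fun p => arcosh (cosh V * cosh p) with hφ
  have hcosh : ∀ p, cosh (φ p) = cosh V * cosh p := fun p => by
    refine cosh_arcosh ?_
    have := one_le_cosh p
    nlinarith
  have hφV : ∀ p ∈ Ioi (0 : ℝ), V < φ p := fun p hp => by
    have h0 : 0 ≤ φ p := arcosh_nonneg (hcV.le.trans (hlt p hp).le)
    have := cosh_lt_cosh.mp ((hcosh p).symm ▸ hlt p hp)
    rwa [abs_of_pos hV, abs_of_nonneg h0] at this
  have himg : φ '' Ioi 0 = Ioi V := by
    refine Subset.antisymm ?_ ?_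
    · rintro _ ⟨p, hp, rfl⟩
      exact hφV p hp
    · intro s hs
      have hs0 : 0 < s := hV.trans hs
      have h1 : 1 < cosh s / cosh V := by
        rw [one_lt_div (by positivity)]
        exact cosh_lt_cosh.mpr (by rwa [abs_of_pos hV, abs_of_pos hs0])
      refine ⟨arcosh (cosh s / cosh V), arcosh_pos h1, ?_⟩
      simp only [hφ]
      rw [cosh_arcosh h1.le, mul_div_cancel₀ _ (by positivity), arcosh_cosh hs0.le]
  have hinj : InjOn φ (Ioi 0) := fun p hp q hq hpq => by
    have h := congrArg cosh hpq
    rw [hcosh, hcosh, mul_right_inj' (by positivity)] at h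
    have := congrArg arcosh h
    rwa [arcosh_cosh (le_of_lt hp), arcosh_cosh (le_of_lt hq)] at this
  have hderiv : ∀ p ∈ Ioi (0 : ℝ), HasDerivWithinAt φ (cosh V * sinh p / sinh (φ p)) (Ioi 0) p := by
    intro p hp
    have h1 : 1 < cosh V * cosh p := hcV.trans (hlt p hp)
    have h := (hasDerivAt_arcosh h1).comp p ((hasDerivAt_cosh p).const_mul (cosh V))
    refine (h.congr_deriv ?_).hasDerivWithinAt
    rw [← hcosh p, ← sinh_sq, sqrt_sq (sinh_nonneg_iff.mpr (hV.trans (hφV p hp)).le)]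
    ring
  rw [← himg, lintegral_image_eq_lintegral_abs_deriv_mul measurableSet_Ioi hderiv hinj]
  refine setLIntegral_congr_fun measurableSet_Ioi fun p hp => ?_
  have hsp : 0 < sinh p := sinh_pos_iff.mpr hp
  have hsφ : 0 < sinh (φ p) := sinh_pos_iff.mpr (hV.trans (hφV p hp))
  have hroot : √(sinh (φ p) ^ 2 - sinh V ^ 2) = cosh V * sinh p := by
    rw [show sinh (φ p) ^ 2 - sinh V ^ 2 = (cosh V * sinh p) ^ 2 by
      rw [sinh_sq (φ p), hcosh, mul_pow, mul_pow, sinh_sq p, sinh_sq V]; ring,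
      sqrt_sq (by positivity)]
  rw [hroot, hcosh, ← ENNReal.ofReal_mul (abs_nonneg _), abs_of_pos (by positivity)]
  congr 1
  field_simp

theorem two_mul_sinh_mul_nonneg (y : ℝ) {v : ℝ} (hv : 0 ≤ v) : 0 ≤ 2 * y * sinh (2 * y * v) := by
  rcases le_total 0 y with hy | hy
  · exact mul_nonneg (by positivity) (sinh_nonneg_iff.mpr (by positivity))
  · refine mul_nonneg_of_nonpos_of_nonpos (by linarith) (sinh_nonpos_iff.mpr ?_)
    exact mul_nonpos_of_nonpos_of_nonneg (by linarith) hv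

theorem lintegral_two_mul_sinh (y : ℝ) {s : ℝ} (hs : 0 ≤ s) :
    ∫⁻ v in Ioo 0 s, ENNReal.ofReal (2 * y * sinh (2 * y * v)) =
      ENNReal.ofReal (cosh (2 * y * s) - 1) := by
  have hd : ∀ v ∈ uIcc 0 s,
      HasDerivAt (fun v => cosh (2 * y * v)) (2 * y * sinh (2 * y * v)) v := by
    intro v _
    have := ((hasDerivAt_id v).const_mul (2 * y)).cosh
    exact this.congr_deriv (by simp; ring)
  have hc : Continuous fun v => 2 * y * sinh (2 * y * v) := by fun_prop
  have h := intervalIntegral.integral_eq_sub_of_hasDerivAt hd (hc.intervalIntegrable _ _)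
  rw [intervalIntegral.integral_of_le hs, integral_Ioc_eq_integral_Ioo] at h
  rw [← ofReal_integral_eq_lintegral_ofReal
    (hc.integrableOn_Icc.mono_set Ioo_subset_Icc_self)
    ((ae_restrict_iff' measurableSet_Ioo).mpr (Filter.Eventually.of_forall fun v hv =>
      two_mul_sinh_mul_nonneg y hv.1.le)), h]
  simp

theorem ofReal_fPol_mul_tanh (y : ℝ) {V : ℝ} (hV : 0 < V) :
    ENNReal.ofReal (fPol (1 / cosh V ^ 2) y * (2 * tanh V)) =
      ∫⁻ v in Ioo 0 V, ENNReal.ofReal (2 * y * sinh (2 * y * v)) * ENNReal.ofReal (sinh v / π) *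
        ENNReal.ofReal (2 * cosh V / sinh V / √(sinh V ^ 2 - sinh v ^ 2)) := by
  have hs : 0 < sinh V := sinh_pos_iff.mpr hV
  have hc : 0 < cosh V := cosh_pos V
  obtain ⟨hi, -⟩ := integral_sinh_mul_sinh_div_sqrt y hV
  have hfun : ∀ v, 2 * y * cosh V / (π * sinh V) *
      (2 * sinh (2 * y * v) * sinh v / √(sinh V ^ 2 - sinh v ^ 2)) =
      2 * y * sinh (2 * y * v) * (sinh v / π) *
      (2 * cosh V / sinh V / √(sinh V ^ 2 - sinh v ^ 2)) := fun v => by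
    rw [← div_div (2 * y * cosh V)]
    ring
  have hnn : ∀ v ∈ Ioo 0 V, 0 ≤ 2 * y * sinh (2 * y * v) * (sinh v / π) *
      (2 * cosh V / sinh V / √(sinh V ^ 2 - sinh v ^ 2)) := fun v hv => by
    have h1 := two_mul_sinh_mul_nonneg y hv.1.le
    have h2 : 0 < sinh v := sinh_pos_iff.mpr hv.1
    exact mul_nonneg (mul_nonneg h1 (by positivity)) (by positivity)
  have hi' := hi.const_mul (2 * y * cosh V / (π * sinh V))
  simp only [hfun] at hi'
  have hval : fPol (1 / cosh V ^ 2) y * (2 * tanh V) =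
      ∫ v in Ioo 0 V, 2 * y * sinh (2 * y * v) * (sinh v / π) *
      (2 * cosh V / sinh V / √(sinh V ^ 2 - sinh v ^ 2)) := by
    simp only [← hfun]
    rw [integral_const_mul, fPol_one_div_cosh_sq y hV, tanh_eq_sinh_div_cosh]
    field_simp
  rw [hval, ofReal_integral_eq_lintegral_ofReal hi'
    ((ae_restrict_iff' measurableSet_Ioo).mpr (Filter.Eventually.of_forall hnn))]
  refine setLIntegral_congr_fun measurableSet_Ioo fun v hv => ?_
  have h1 := two_mul_sinh_mul_nonneg y hv.1.le
  have h2 : 0 < sinh v := sinh_pos_iff.mpr hv.1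
  rw [ENNReal.ofReal_mul (by positivity), ENNReal.ofReal_mul (by positivity)]

/-- The Abel type transform of `f_t(y)` recovers `cosh (2 y s) - 1`. -/
theorem lintegral_fPol_mul_lintegral_exp (y β : ℝ) :
    ∫⁻ V in Ioi (0 : ℝ), ENNReal.ofReal (fPol (1 / cosh V ^ 2) y * (2 * tanh V)) *
        ∫⁻ p in Ioi (0 : ℝ), ENNReal.ofReal (exp (-β * (cosh V * cosh p))) =
      ∫⁻ s in Ioi (0 : ℝ), ENNReal.ofReal (exp (-β * cosh s) * (cosh (2 * y * s) - 1)) := by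
  set A : ℝ → ENNReal := fun v =>
    ENNReal.ofReal (2 * y * sinh (2 * y * v)) * ENNReal.ofReal (sinh v / π) with hA
  set B : ℝ → ENNReal := fun s => ENNReal.ofReal (exp (-β * cosh s) * sinh s) with hB
  set H : ℝ → ℝ → ℝ → ENNReal := fun V v s => (Ioo v s).indicator (fun V =>
    ENNReal.ofReal (2 * cosh V / sinh V /
      (√(sinh V ^ 2 - sinh v ^ 2) * √(sinh s ^ 2 - sinh V ^ 2)))) V with hH
  have hHm : Measurable fun q : ℝ × ℝ × ℝ => H q.1 q.2.1 q.2.2 := by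
    have hset : MeasurableSet {q : ℝ × ℝ × ℝ | q.2.1 < q.1 ∧ q.1 < q.2.2} :=
      (measurableSet_lt measurable_snd.fst measurable_fst).inter
        (measurableSet_lt measurable_fst measurable_snd.snd)
    have hg : Measurable fun q : ℝ × ℝ × ℝ => ENNReal.ofReal (2 * cosh q.1 / sinh q.1 /
      (√(sinh q.1 ^ 2 - sinh q.2.1 ^ 2) * √(sinh q.2.2 ^ 2 - sinh q.1 ^ 2))) := by
      have := measurable_cosh
      have := measurable_sinh
      fun_prop
    exact hg.indicator hset
  have hAm : Measurable A := by fun_prop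
  have hBm : Measurable B := by fun_prop
  have hm : Measurable fun q : ℝ × ℝ × ℝ => A q.2.1 * B q.2.2 * H q.1 q.2.1 q.2.2 := by
    fun_prop
  have hleft : ∀ V ∈ Ioi (0 : ℝ), ENNReal.ofReal (fPol (1 / cosh V ^ 2) y * (2 * tanh V)) *
        ∫⁻ p in Ioi (0 : ℝ), ENNReal.ofReal (exp (-β * (cosh V * cosh p))) =
      ∫⁻ v in Ioi (0 : ℝ), ∫⁻ s in Ioi (0 : ℝ), A v * B s * H V v s := by
    intro V hV
    have hc : 0 < 2 * cosh V / sinh V := by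
      have := sinh_pos_iff.mpr hV
      have := cosh_pos V
      positivity
    have hpt : ∀ v ∈ Ioi (0 : ℝ), ∀ s ∈ Ioi (0 : ℝ), A v * B s * H V v s =
        (Iio V).indicator (fun v => A v *
          ENNReal.ofReal (2 * cosh V / sinh V / √(sinh V ^ 2 - sinh v ^ 2))) v *
        (Ioi V).indicator (fun s => ENNReal.ofReal
          (exp (-β * cosh s) * sinh s / √(sinh s ^ 2 - sinh V ^ 2))) s := by
      intro v hv s hs
      by_cases hvV : v < V
      · by_cases hVs : V < s
        · have hs0 : 0 < sinh s := sinh_pos_iff.mpr hs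
          simp only [hH, hB]
          rw [indicator_of_mem (mem_Iio.mpr hvV), indicator_of_mem (mem_Ioi.mpr hVs),
            indicator_of_mem (mem_Ioo.mpr ⟨hvV, hVs⟩)]
          generalize A v = α
          rw [mul_assoc, mul_assoc, ← ENNReal.ofReal_mul (by positivity),
            ← ENNReal.ofReal_mul (by positivity)]
          congr 2
          ring
        · simp [hH, hVs]
      · simp [hH, hvV]
    rw [setLIntegral_congr_fun measurableSet_Ioi fun v hv =>
      setLIntegral_congr_fun measurableSet_Ioi (hpt v hv)]
    rw [lintegral_congr fun v => lintegral_const_mul _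
      (Measurable.indicator (by fun_prop) measurableSet_Ioi), lintegral_mul_const _
      (Measurable.indicator (by fun_prop) measurableSet_Iio),
      lintegral_indicator measurableSet_Iio, lintegral_indicator measurableSet_Ioi,
      Measure.restrict_restrict measurableSet_Iio, Measure.restrict_restrict measurableSet_Ioi,
      inter_comm (Iio V), Ioi_inter_Iio,
      inter_eq_left.mpr (Ioi_subset_Ioi (le_of_lt hV)), ofReal_fPol_mul_tanh y hV,
      lintegral_exp_neg_mul_cosh_mul_cosh β hV]
  have hright : ∀ v ∈ Ioi (0 : ℝ), ∀ s, ∫⁻ V in Ioi (0 : ℝ), A v * B s * H V v s =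
      (Iio s).indicator (fun v => A v * B s * ENNReal.ofReal (π / (sinh v * sinh s))) v := by
    intro v hv s
    rw [lintegral_const_mul _ (by fun_prop), lintegral_indicator measurableSet_Ioo,
      Measure.restrict_restrict measurableSet_Ioo,
      inter_eq_left.mpr (show Ioo v s ⊆ Ioi 0 from fun V hV => (mem_Ioi.mp hv).trans hV.1)]
    by_cases hvs : v < s
    · rw [lintegral_coth_div_sqrt_mul_sqrt hv hvs, indicator_of_mem (mem_Iio.mpr hvs)]
    · rw [Ioo_eq_empty hvs, indicator_of_notMem (by simpa using hvs)]
      simp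
  calc _ = ∫⁻ V in Ioi (0 : ℝ), ∫⁻ v in Ioi (0 : ℝ), ∫⁻ s in Ioi (0 : ℝ), A v * B s * H V v s :=
        setLIntegral_congr_fun measurableSet_Ioi hleft
    _ = ∫⁻ v in Ioi (0 : ℝ), ∫⁻ V in Ioi (0 : ℝ), ∫⁻ s in Ioi (0 : ℝ), A v * B s * H V v s := by
        refine lintegral_lintegral_swap (Measurable.aemeasurable ?_)
        exact Measurable.lintegral_prod_right' (f := fun q : (ℝ × ℝ) × ℝ =>
          A q.1.2 * B q.2 * H q.1.1 q.1.2 q.2)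
          (hm.comp (f := fun q : (ℝ × ℝ) × ℝ => (q.1.1, q.1.2, q.2)) (by fun_prop))
    _ = ∫⁻ v in Ioi (0 : ℝ), ∫⁻ s in Ioi (0 : ℝ), ∫⁻ V in Ioi (0 : ℝ), A v * B s * H V v s := by
        refine lintegral_congr fun v => lintegral_lintegral_swap (Measurable.aemeasurable ?_)
        exact hm.comp (f := fun q : ℝ × ℝ => (q.1, v, q.2)) (by fun_prop)
    _ = ∫⁻ s in Ioi (0 : ℝ), ∫⁻ v in Ioi (0 : ℝ), ∫⁻ V in Ioi (0 : ℝ), A v * B s * H V v s := by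
        refine lintegral_lintegral_swap (Measurable.aemeasurable ?_)
        exact Measurable.lintegral_prod_right' (f := fun q : (ℝ × ℝ) × ℝ =>
          A q.1.1 * B q.1.2 * H q.2 q.1.1 q.1.2)
          (hm.comp (f := fun q : (ℝ × ℝ) × ℝ => (q.2, q.1.1, q.1.2)) (by fun_prop))
    _ = _ := by
        refine setLIntegral_congr_fun measurableSet_Ioi fun s hs => ?_
        have hs0 : 0 < sinh s := sinh_pos_iff.mpr hs
        rw [setLIntegral_congr_fun measurableSet_Ioi fun v hv => hright v hv s,
          lintegral_indicator measurableSet_Iio, Measure.restrict_restrict measurableSet_Iio,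
          inter_comm, Ioi_inter_Iio, ENNReal.ofReal_mul (exp_pos _).le,
          ← lintegral_two_mul_sinh y (le_of_lt hs), ← lintegral_const_mul _ (by fun_prop)]
        refine setLIntegral_congr_fun measurableSet_Ioo fun v hv => ?_
        have hv0 : 0 < sinh v := sinh_pos_iff.mpr hv.1
        have h1 := two_mul_sinh_mul_nonneg y hv.1.le
        simp only [hA, hB]
        rw [← ENNReal.ofReal_mul h1, ← ENNReal.ofReal_mul (by positivity),
          ← ENNReal.ofReal_mul (by positivity), ← ENNReal.ofReal_mul (by positivity)]
        congr 1
        field_simp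

theorem hasDerivAt_one_div_cosh_sq (V : ℝ) :
    HasDerivAt (fun V => 1 / cosh V ^ 2) (-(2 * sinh V / cosh V ^ 3)) V := by
  have hc : 0 < cosh V := cosh_pos V
  have h := ((hasDerivAt_cosh V).pow 2).inv (by simp [hc.ne'])
  simp only [one_div]
  refine h.congr_deriv ?_
  simp only [Pi.pow_apply]
  field_simp
  norm_num
  ring

theorem injOn_one_div_cosh_sq : InjOn (fun V => 1 / cosh V ^ 2) (Ioi (0 : ℝ)) := by
  intro V hV W hW h
  have hVc := cosh_pos V
  have hWc := cosh_pos W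
  have h1 : cosh V ^ 2 = cosh W ^ 2 := by
    simpa using h
  have h2 : cosh V = cosh W := (pow_left_inj₀ hVc.le hWc.le two_ne_zero).mp h1
  have := congrArg arcosh h2
  rwa [arcosh_cosh (le_of_lt hV), arcosh_cosh (le_of_lt hW)] at this

theorem one_div_cosh_sq_mem_Ioo {V : ℝ} (hV : 0 < V) : 1 / cosh V ^ 2 ∈ Ioo (0 : ℝ) 1 := by
  have h1 : 1 < cosh V := one_lt_cosh.mpr hV.ne'
  refine ⟨by positivity, ?_⟩
  rw [div_lt_one (by positivity)]
  nlinarith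

theorem image_one_div_cosh_sq : (fun V => 1 / cosh V ^ 2) '' Ioi (0 : ℝ) = Ioo 0 1 := by
  refine Subset.antisymm ?_ ?_
  · rintro _ ⟨V, hV, rfl⟩
    exact one_div_cosh_sq_mem_Ioo hV
  · rintro t ⟨h0, h1⟩
    have hs : 0 < √t := sqrt_pos.mpr h0
    have h2 : 1 < 1 / √t := by
      rw [one_lt_div hs, sqrt_lt' one_pos]
      simpa using h1
    refine ⟨arcosh (1 / √t), arcosh_pos h2, ?_⟩
    simp only
    rw [cosh_arcosh h2.le, div_pow, sq_sqrt h0.le]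
    simp

theorem abs_deriv_smul_div_eq (g : ℝ → ℝ) {V : ℝ} (hV : 0 < V) :
    |(-(2 * sinh V / cosh V ^ 3))| • (g (1 / cosh V ^ 2) / (1 / cosh V ^ 2)) =
      g (1 / cosh V ^ 2) * (2 * tanh V) := by
  have hs : 0 < sinh V := sinh_pos_iff.mpr hV
  have hc := cosh_pos V
  rw [abs_neg, abs_of_pos (by positivity), smul_eq_mul, tanh_eq_sinh_div_cosh]
  field_simp

theorem integrableOn_div_iff_one_div_cosh_sq (g : ℝ → ℝ) :
    IntegrableOn (fun t => g t / t) (Ioo 0 1) ↔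
      IntegrableOn (fun V => g (1 / cosh V ^ 2) * (2 * tanh V)) (Ioi 0) := by
  rw [← image_one_div_cosh_sq, integrableOn_image_iff_integrableOn_abs_deriv_smul
    measurableSet_Ioi (fun V _ => (hasDerivAt_one_div_cosh_sq V).hasDerivWithinAt)
    injOn_one_div_cosh_sq]
  exact integrableOn_congr_fun (fun V hV => abs_deriv_smul_div_eq g hV) measurableSet_Ioi

theorem integral_div_eq_one_div_cosh_sq (g : ℝ → ℝ) :
    ∫ t in Ioo 0 1, g t / t = ∫ V in Ioi 0, g (1 / cosh V ^ 2) * (2 * tanh V) := by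
  rw [← image_one_div_cosh_sq, integral_image_eq_integral_abs_deriv_smul
    measurableSet_Ioi (fun V _ => (hasDerivAt_one_div_cosh_sq V).hasDerivWithinAt)
    injOn_one_div_cosh_sq]
  exact setIntegral_congr_fun measurableSet_Ioi fun V hV => abs_deriv_smul_div_eq g hV

/-- The linear change of variables `(p, q) ↦ (p + q, p - q)` of the plane. -/
theorem map_add_sub_volume :
    Measure.map (fun z : ℝ × ℝ => (z.1 + z.2, z.1 - z.2)) volume =
      ENNReal.ofReal (1 / 2) • (volume : Measure (ℝ × ℝ)) := by
  set L := Matrix.toLin (Module.Basis.finTwoProd ℝ) (Module.Basis.finTwoProd ℝ)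
    !![1, 1; 1, -1] with hL
  have hdet : LinearMap.det L = -2 := by
    rw [hL, LinearMap.det_toLin, Matrix.det_fin_two_of]
    norm_num
  have hfun : (fun z : ℝ × ℝ => (z.1 + z.2, z.1 - z.2)) = L := by
    funext z
    rw [hL, Matrix.toLin_finTwoProd_apply]
    simp [sub_eq_add_neg]
  rw [hfun, Measure.map_linearMap_addHaar_eq_smul_addHaar _ (by rw [hdet]; norm_num), hdet]
  norm_num

theorem integrable_add_sub {F : ℝ × ℝ → ℂ} (hF : Integrable F) :
    Integrable fun z : ℝ × ℝ => F (z.1 + z.2, z.1 - z.2) := by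
  have hm : Integrable F (Measure.map (fun z : ℝ × ℝ => (z.1 + z.2, z.1 - z.2)) volume) := by
    rw [map_add_sub_volume]
    exact hF.smul_measure ENNReal.ofReal_ne_top
  exact hm.comp_measurable (by fun_prop)

theorem integral_add_sub {F : ℝ × ℝ → ℂ} (hF : Integrable F) :
    ∫ z : ℝ × ℝ, F (z.1 + z.2, z.1 - z.2) = (1 / 2) * ∫ z, F z := by
  have hm : AEStronglyMeasurable F
      (Measure.map (fun z : ℝ × ℝ => (z.1 + z.2, z.1 - z.2)) volume) := by
    rw [map_add_sub_volume]
    exact hF.1.smul_measure _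
  rw [← integral_map (f := F) (by fun_prop) hm, map_add_sub_volume, integral_smul_measure]
  simp

theorem sq_div_two_le_cosh (u : ℝ) : u ^ 2 / 2 ≤ cosh u := by
  have h : (u / 2) ^ 2 ≤ sinh (u / 2) ^ 2 := by
    rw [sq_le_sq, abs_sinh]
    exact self_le_sinh_iff.mpr (abs_nonneg _)
  have h2 := cosh_two_mul (u / 2)
  rw [mul_div_cancel₀ _ (two_ne_zero' ℝ), cosh_sq] at h2
  nlinarith

theorem integrable_exp_neg_mul_cosh_mul_exp {b : ℝ} (hb : 0 < b) (w : ℂ) :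
    Integrable fun u : ℝ => Complex.exp (-(b : ℂ) * (cosh u : ℂ)) * Complex.exp (w * u) := by
  have hg := (integrable_cexp_quadratic' (b := ((-(b / 2) : ℝ) : ℂ))
    (by simpa using hb) w 0).norm
  refine hg.mono' (by fun_prop) (Filter.Eventually.of_forall fun u => ?_)
  rw [← Complex.exp_add, Complex.norm_exp, Complex.norm_exp]
  refine exp_le_exp.mpr ?_
  have h := mul_le_mul_of_nonneg_left (sq_div_two_le_cosh u) hb.le
  rw [show -(b : ℂ) * (cosh u : ℂ) = ((-(b * cosh u) : ℝ) : ℂ) by push_cast; ring,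
    show ((-(b / 2) : ℝ) : ℂ) * (u : ℂ) ^ 2 = ((-(b * (u ^ 2 / 2)) : ℝ) : ℂ) by push_cast; ring]
  simp only [Complex.add_re, Complex.ofReal_re, Complex.zero_re]
  linarith

theorem Kbes_eq_integral {b : ℝ} (hb : 0 < b) (w : ℂ) :
    Kbes b w = (1 / 2) *
      ∫ u : ℝ, Complex.exp (-(b : ℂ) * (cosh u : ℂ)) * Complex.exp (w * u) := by
  have hi := integrable_exp_neg_mul_cosh_mul_exp hb w
  have hpt : ∀ u : ℝ, Complex.exp (-(b : ℂ) * (cosh u : ℂ)) * Complex.cosh (w * u) =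
      (1 / 2) * (Complex.exp (-(b : ℂ) * (cosh u : ℂ)) * Complex.exp (w * u) +
        Complex.exp (-(b : ℂ) * (cosh (-u) : ℂ)) * Complex.exp (w * (-u : ℝ))) := by
    intro u
    rw [cosh_neg, Complex.cosh, Complex.ofReal_neg, mul_neg]
    ring
  have hneg := integral_comp_neg_Ioi 0 fun u : ℝ =>
    Complex.exp (-(b : ℂ) * (cosh u : ℂ)) * Complex.exp (w * u)
  rw [Kbes]
  simp only [hpt]
  rw [integral_const_mul, integral_add hi.integrableOn hi.comp_neg.integrableOn, hneg, neg_zero,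
    add_comm, intervalIntegral.integral_Iic_add_Ioi hi.integrableOn hi.integrableOn]

/-- Product formula: `K_w(b) K_{w'}(b)` as an integral of `K_{w+w'}(2 b cosh q)`. -/
theorem Kbes_mul_Kbes {b : ℝ} (hb : 0 < b) (w w' : ℂ) :
    Integrable (fun q : ℝ => Complex.exp ((w - w') * q) * Kbes (2 * b * cosh q) (w + w')) ∧
    Kbes b w * Kbes b w' =
      ∫ q : ℝ, Complex.exp ((w - w') * q) * Kbes (2 * b * cosh q) (w + w') := by
  set F : ℝ × ℝ → ℂ := fun z =>
    (Complex.exp (-(b : ℂ) * (cosh z.1 : ℂ)) * Complex.exp (w * z.1)) *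
    (Complex.exp (-(b : ℂ) * (cosh z.2 : ℂ)) * Complex.exp (w' * z.2)) with hF
  have hFi : Integrable F := (integrable_exp_neg_mul_cosh_mul_exp hb w).mul_prod
    (integrable_exp_neg_mul_cosh_mul_exp hb w')
  have hFv : ∫ z, F z = 4 * (Kbes b w * Kbes b w') := by
    rw [Kbes_eq_integral hb, Kbes_eq_integral hb, Measure.volume_eq_prod, hF,
      integral_prod_mul (fun u : ℝ => Complex.exp (-(b : ℂ) * (cosh u : ℂ)) * Complex.exp (w * u))
        (fun u : ℝ => Complex.exp (-(b : ℂ) * (cosh u : ℂ)) * Complex.exp (w' * u))]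
    ring
  have hpt : ∀ p q : ℝ, F (p + q, p - q) = Complex.exp ((w - w') * q) *
      (Complex.exp (-((2 * b * cosh q : ℝ) : ℂ) * (cosh p : ℂ)) *
        Complex.exp ((w + w') * p)) := by
    intro p q
    simp only [hF]
    rw [← Complex.exp_add, ← Complex.exp_add, ← Complex.exp_add, ← Complex.exp_add,
      ← Complex.exp_add, cosh_add, cosh_sub]
    congr 1
    push_cast
    ring
  have hTi := integrable_add_sub hFi
  have hTv := integral_add_sub hFi
  have hin : ∀ q : ℝ, ∫ p : ℝ, F (p + q, p - q) =
      2 * (Complex.exp ((w - w') * q) * Kbes (2 * b * cosh q) (w + w')) := by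
    intro q
    simp only [hpt]
    rw [integral_const_mul, Kbes_eq_integral (by have := cosh_pos q; positivity)]
    ring
  rw [Measure.volume_eq_prod] at hTi hTv
  rw [integral_prod_symm _ hTi] at hTv
  have hI := hTi.integral_prod_right
  simp only [hin] at hI hTv
  rw [integral_const_mul, ← Measure.volume_eq_prod, hFv] at hTv
  refine ⟨?_, by linear_combination -(1 / 2 : ℂ) * hTv⟩
  refine (hI.const_mul (1 / 2)).congr (Filter.Eventually.of_forall fun q => ?_)
  simp only
  ring

/-- The modified Bessel function `K_ν(β)` of real order `ν`, as a real number. -/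
noncomputable def besselK (ν β : ℝ) : ℝ :=
  ∫ p in Ioi (0 : ℝ), exp (-β * cosh p) * cosh (ν * p)

theorem besselK_neg (ν β : ℝ) : besselK (-ν) β = besselK ν β := by
  simp [besselK]

theorem Kbes_ofReal (ν β : ℝ) : Kbes β (ν : ℂ) = (besselK ν β : ℂ) := by
  rw [Kbes, besselK, ← integral_complex_ofReal]
  push_cast
  rfl

theorem Kbes_I_mul_ofReal (b x : ℝ) : Kbes b (Complex.I * x) = (Kre b x : ℂ) := by
  rw [Kbes, Kre, ← integral_complex_ofReal]
  refine integral_congr_ae (Filter.Eventually.of_forall fun u => ?_)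
  simp only
  rw [mul_assoc, mul_comm Complex.I, Complex.cosh_mul_I]
  push_cast
  rfl

theorem Kbes_conj (b : ℝ) (w : ℂ) :
    Kbes b ((starRingEnd ℂ) w) = (starRingEnd ℂ) (Kbes b w) := by
  rw [Kbes, Kbes, ← integral_conj]
  refine integral_congr_ae (Filter.Eventually.of_forall fun u => ?_)
  simp [← Complex.exp_conj, ← Complex.cosh_conj]

theorem integrableOn_exp_neg_mul_cosh_mul_cosh {β : ℝ} (hβ : 0 < β) (ν : ℝ) :
    IntegrableOn (fun p => exp (-β * cosh p) * cosh (ν * p)) (Ioi 0) := by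
  have h1 := (integrable_exp_neg_mul_cosh_mul_exp hβ (ν : ℂ)).re
  have h2 := (integrable_exp_neg_mul_cosh_mul_exp hβ ((-ν : ℝ) : ℂ)).re
  refine (((h1.add h2).const_mul (1 / 2)).congr
    (Filter.Eventually.of_forall fun u => ?_)).integrableOn
  have hre : ∀ k : ℝ, Complex.exp (-(β : ℂ) * (cosh u : ℂ)) * Complex.exp ((k : ℂ) * u) =
      ((exp (-β * cosh u) * exp (k * u) : ℝ) : ℂ) := fun k => by push_cast; rfl
  simp only [Pi.add_apply, hre]
  simp only [RCLike.re_to_complex, Complex.ofReal_re]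
  rw [cosh_eq (ν * u)]
  ring_nf

theorem integrable_cos_mul_besselK {b : ℝ} (hb : 0 < b) (x y : ℝ) :
    Integrable (fun q => cos (2 * x * q) * besselK (2 * y) (2 * b * cosh q)) ∧
    Complex.normSq (Kbes b (Complex.I * (x + y * Complex.I))) =
      ∫ q, cos (2 * x * q) * besselK (2 * y) (2 * b * cosh q) := by
  set w : ℂ := Complex.I * (x + y * Complex.I) with hw
  have hw1 : w + (starRingEnd ℂ) w = ((-(2 * y) : ℝ) : ℂ) := by
    rw [hw, Complex.add_conj]
    simp
  have hw2 : w - (starRingEnd ℂ) w = ((2 * x : ℝ) : ℂ) * Complex.I := by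
    rw [hw, Complex.sub_conj]
    simp
  have hpt : ∀ q : ℝ, RCLike.re (Complex.exp ((w - (starRingEnd ℂ) w) * q) *
      Kbes (2 * b * cosh q) (w + (starRingEnd ℂ) w)) =
      cos (2 * x * q) * besselK (2 * y) (2 * b * cosh q) := by
    intro q
    rw [hw1, hw2, Kbes_ofReal, besselK_neg, RCLike.re_to_complex, Complex.re_mul_ofReal,
      mul_right_comm, ← Complex.ofReal_mul, Complex.exp_ofReal_mul_I_re]
  obtain ⟨hi, hv⟩ := Kbes_mul_Kbes hb w ((starRingEnd ℂ) w)
  refine ⟨hi.re.congr (Filter.Eventually.of_forall hpt), ?_⟩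
  rw [Kbes_conj, Complex.mul_conj] at hv
  have h := congrArg Complex.re hv
  rw [Complex.ofReal_re, ← RCLike.re_to_complex, ← integral_re hi] at h
  rw [h]
  exact integral_congr_ae (Filter.Eventually.of_forall hpt)

theorem Kre_sq_eq_integral {b : ℝ} (hb : 0 < b) (x : ℝ) :
    Kre b x ^ 2 = ∫ q, cos (2 * x * q) * besselK 0 (2 * b * cosh q) := by
  have h := (integrable_cos_mul_besselK hb x 0).2
  rw [mul_zero] at h
  rw [← h]
  simp [Kbes_I_mul_ofReal, Complex.normSq_ofReal, sq]

theorem integrable_besselK_cosh {b : ℝ} (hb : 0 < b) (y : ℝ) :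
    Integrable fun q => besselK (2 * y) (2 * b * cosh q) := by
  simpa using (integrable_cos_mul_besselK hb 0 y).1

theorem besselK_nonneg (ν β : ℝ) : 0 ≤ besselK ν β :=
  integral_nonneg fun _ => mul_nonneg (exp_pos _).le (cosh_pos _).le

theorem ofReal_besselK_zero {β : ℝ} (hβ : 0 < β) :
    ENNReal.ofReal (besselK 0 β) = ∫⁻ p in Ioi (0 : ℝ), ENNReal.ofReal (exp (-β * cosh p)) := by
  rw [besselK, ofReal_integral_eq_lintegral_ofReal (integrableOn_exp_neg_mul_cosh_mul_cosh hβ 0)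
    (Filter.Eventually.of_forall fun p => mul_nonneg (exp_pos _).le (cosh_pos _).le)]
  simp

theorem measurable_besselK (ν : ℝ) : Measurable (besselK ν) := by
  have h : StronglyMeasurable fun z : ℝ × ℝ => exp (-z.1 * cosh z.2) * cosh (ν * z.2) :=
    Continuous.stronglyMeasurable (by fun_prop)
  exact (h.integral_prod_right (ν := volume.restrict (Ioi 0))).measurable

theorem measurable_fPol (y : ℝ) : Measurable fun t => fPol t y := by
  have : Measurable (Sgauss y) := Measurable.tsum fun k => by fun_prop
  unfold fPol
  fun_prop

/-- The transform of `lintegral_fPol_mul_lintegral_exp` expressed with Bessel functions. -/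
theorem lintegral_fPol_mul_besselK (y : ℝ) {β : ℝ} (hβ : 0 < β) :
    ∫⁻ V in Ioi (0 : ℝ),
        ENNReal.ofReal (fPol (1 / cosh V ^ 2) y * (2 * tanh V) * besselK 0 (β * cosh V)) =
      ENNReal.ofReal (besselK (2 * y) β - besselK 0 β) := by
  have hnn : ∀ s, 0 ≤ exp (-β * cosh s) * (cosh (2 * y * s) - 1) := fun s =>
    mul_nonneg (exp_pos _).le (sub_nonneg.mpr (one_le_cosh _))
  have hi : ∀ s, exp (-β * cosh s) * (cosh (2 * y * s) - 1) =
      exp (-β * cosh s) * cosh (2 * y * s) - exp (-β * cosh s) * cosh (0 * s) := fun s => by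
    rw [zero_mul, cosh_zero]
    ring
  have h1 := integrableOn_exp_neg_mul_cosh_mul_cosh hβ (2 * y)
  have h0 := integrableOn_exp_neg_mul_cosh_mul_cosh hβ 0
  have hE := lintegral_fPol_mul_lintegral_exp y β
  rw [← ofReal_integral_eq_lintegral_ofReal (by simp only [hi]; exact h1.sub h0)
    (Filter.Eventually.of_forall hnn)] at hE
  simp only [hi] at hE
  rw [integral_sub h1 h0] at hE
  rw [besselK, besselK, ← hE]
  refine setLIntegral_congr_fun measurableSet_Ioi fun V hV => ?_
  have hf := fPol_nonneg (one_div_cosh_sq_mem_Ioo hV) y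
  have ht : 0 < tanh V := by
    rw [tanh_eq_sinh_div_cosh]
    exact div_pos (sinh_pos_iff.mpr hV) (cosh_pos V)
  have := cosh_pos V
  rw [ENNReal.ofReal_mul (by positivity), ofReal_besselK_zero (by positivity)]
  simp only [neg_mul, mul_assoc]

/-- `|K_{i(x+iy)}(a)|² - K_{ix}(a)²` as an absolutely convergent integral of `f_t(y)` against
`K_{ix}(a/√t)² dt/t`. -/
theorem integral_fPol_mul_Kre_sq {a : ℝ} (ha : 0 < a) (x y : ℝ) :
    IntegrableOn (fun t => fPol t y * Kre (a / √t) x ^ 2 / t) (Ioo 0 1) ∧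
    ∫ t in Ioo (0 : ℝ) 1, fPol t y * Kre (a / √t) x ^ 2 / t =
      Complex.normSq (Kbes a (Complex.I * (x + y * Complex.I))) - Kre a x ^ 2 := by
  rw [integrableOn_div_iff_one_div_cosh_sq fun t => fPol t y * Kre (a / √t) x ^ 2,
    integral_div_eq_one_div_cosh_sq fun t => fPol t y * Kre (a / √t) x ^ 2]
  set g : ℝ → ℝ := fun V => fPol (1 / cosh V ^ 2) y * (2 * tanh V) with hg
  have hgnn : ∀ V ∈ Ioi (0 : ℝ), 0 ≤ g V := fun V hV => by
    have hf := fPol_nonneg (one_div_cosh_sq_mem_Ioo hV) y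
    have ht : 0 < tanh V := by
      rw [tanh_eq_sinh_div_cosh]
      exact div_pos (sinh_pos_iff.mpr hV) (cosh_pos V)
    positivity
  have hgm : Measurable g := by
    have := measurable_fPol y
    simp only [hg, tanh_eq_sinh_div_cosh]
    fun_prop
  have hKm := measurable_besselK 0
  have hβ : ∀ q, 0 < 2 * a * cosh q := fun q => by
    have := cosh_pos q
    positivity
  set Φ : ℝ → ℝ → ℝ := fun V q =>
    cos (2 * x * q) * (g V * besselK 0 (2 * a * cosh q * cosh V)) with hΦ
  have hΦm : Measurable (Function.uncurry Φ) := by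
    simp only [hΦ, Function.uncurry_def]
    fun_prop
  have hdiff := (integrable_besselK_cosh ha y).sub (integrable_besselK_cosh ha 0)
  simp only [mul_zero] at hdiff
  have hΦi : Integrable (Function.uncurry Φ) ((volume.restrict (Ioi 0)).prod volume) := by
    refine ⟨hΦm.aestronglyMeasurable, ?_⟩
    rw [hasFiniteIntegral_iff_enorm, lintegral_prod_symm _ hΦm.enorm.aemeasurable]
    refine lt_of_le_of_lt (lintegral_mono fun q => ?_) hdiff.2
    calc ∫⁻ V in Ioi 0, ‖Function.uncurry Φ (V, q)‖ₑ
        ≤ ∫⁻ V in Ioi 0, ENNReal.ofReal (g V * besselK 0 (2 * a * cosh q * cosh V)) := by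
          refine setLIntegral_mono' measurableSet_Ioi fun V hV => ?_
          rw [← ofReal_norm]
          refine ENNReal.ofReal_le_ofReal ?_
          have h := mul_nonneg (hgnn V hV) (besselK_nonneg 0 (2 * a * cosh q * cosh V))
          rw [Function.uncurry_apply_pair, norm_mul, norm_of_nonneg h]
          exact mul_le_of_le_one_left h (abs_cos_le_one _)
      _ = ENNReal.ofReal (besselK (2 * y) (2 * a * cosh q) - besselK 0 (2 * a * cosh q)) :=
          lintegral_fPol_mul_besselK y (hβ q)
      _ ≤ _ := by
          rw [← ofReal_norm]
          exact ENNReal.ofReal_le_ofReal (le_abs_self _)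
  have hinner : ∀ V, ∫ q, Φ V q =
      fPol (1 / cosh V ^ 2) y * Kre (a / √(1 / cosh V ^ 2)) x ^ 2 * (2 * tanh V) := by
    intro V
    have hc := cosh_pos V
    rw [show a / √(1 / cosh V ^ 2) = a * cosh V by
      rw [sqrt_div zero_le_one, sqrt_sq hc.le]; simp, Kre_sq_eq_integral (by positivity),
      mul_right_comm, ← integral_const_mul]
    refine integral_congr_ae (Filter.Eventually.of_forall fun q => ?_)
    simp only [hΦ, hg]
    rw [show 2 * a * cosh q * cosh V = 2 * (a * cosh V) * cosh q by ring]
    ring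
  have hle : ∀ β, 0 < β → besselK 0 β ≤ besselK (2 * y) β := fun β hβ =>
    setIntegral_mono_on (integrableOn_exp_neg_mul_cosh_mul_cosh hβ 0)
      (integrableOn_exp_neg_mul_cosh_mul_cosh hβ _) measurableSet_Ioi fun p _ => by
        rw [zero_mul, cosh_zero]
        exact mul_le_mul_of_nonneg_left (one_le_cosh _) (exp_pos _).le
  have houter : ∀ q, ∫ V in Ioi 0, Φ V q = cos (2 * x * q) * besselK (2 * y) (2 * a * cosh q) -
      cos (2 * x * q) * besselK 0 (2 * a * cosh q) := by
    intro q
    simp only [hΦ]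
    rw [integral_const_mul, integral_eq_lintegral_of_nonneg_ae
      ((ae_restrict_iff' measurableSet_Ioi).mpr (Filter.Eventually.of_forall fun V hV =>
        mul_nonneg (hgnn V hV) (besselK_nonneg _ _)))
      (Measurable.aestronglyMeasurable (by fun_prop)), lintegral_fPol_mul_besselK y (hβ q),
      ENNReal.toReal_ofReal (sub_nonneg.mpr (hle _ (hβ q)))]
    ring
  refine ⟨hΦi.integral_prod_left.congr (Filter.Eventually.of_forall hinner), ?_⟩
  have h0 := (integrable_cos_mul_besselK ha x 0).1
  rw [mul_zero] at h0
  rw [(integrable_cos_mul_besselK ha x y).2, Kre_sq_eq_integral ha,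
    ← integral_sub (integrable_cos_mul_besselK ha x y).1 h0]
  simp only [← houter, ← hinner]
  exact integral_integral_swap hΦi

/-- if `F_{a,c}(x₀+iy₀) = 0` then the corresponding integral vanishes. -/
theorem Fac_zero_integral_eq_zero (a c : ℝ) (ha : 0 < a) (hc : 0 < c) (x₀ y₀ : ℝ)
    (h : Fac a c ((x₀:ℂ) + (y₀:ℂ) * Complex.I) = 0) :
    IntegrableOn
      (fun t : ℝ => (fPol t (y₀ + c) - fPol t (y₀ - c)) * (Kre (a / Real.sqrt t) x₀)^2 / t)
      (Ioo (0:ℝ) 1) ∧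
    ∫ t in Ioo (0:ℝ) 1,
        (fPol t (y₀ + c) - fPol t (y₀ - c)) * (Kre (a / Real.sqrt t) x₀)^2 / t = 0 := by
  obtain ⟨hi₁, hv₁⟩ := integral_fPol_mul_Kre_sq ha x₀ (y₀ + c)
  obtain ⟨hi₂, hv₂⟩ := integral_fPol_mul_Kre_sq ha x₀ (y₀ - c)
  have hfun : ∀ t : ℝ, (fPol t (y₀ + c) - fPol t (y₀ - c)) * (Kre (a / √t) x₀) ^ 2 / t =
      fPol t (y₀ + c) * Kre (a / √t) x₀ ^ 2 / t - fPol t (y₀ - c) * Kre (a / √t) x₀ ^ 2 / t :=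
    fun t => by ring
  simp only [hfun]
  refine ⟨hi₁.sub hi₂, ?_⟩
  rw [integral_sub hi₁ hi₂, hv₁, hv₂]
  have h₁ : (x₀ : ℂ) + ((y₀ + c : ℝ) : ℂ) * Complex.I =
      (x₀ : ℂ) + (y₀ : ℂ) * Complex.I + Complex.I * c := by push_cast; ring
  have h₂ : (x₀ : ℂ) + ((y₀ - c : ℝ) : ℂ) * Complex.I =
      (x₀ : ℂ) + (y₀ : ℂ) * Complex.I - Complex.I * c := by push_cast; ring
  rw [h₁, h₂, eq_neg_of_add_eq_zero_left h, Complex.normSq_neg]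
  ring
end

section
/- Let 0 < t < 1 and c > 0. Then for every real y: f_t(y + c) − f_t(y − c) > 0 if y > 0; f_t(y + c) − f_t(y − c) = 0 if y = 0; and f_t(y + c) − f_t(y − c) < 0 if y < 0. -/
open MeasureTheory Real Set

/-- The coefficient sequence `a` defines a power series converging absolutely on the unit disc. -/
def UnitDiscSummable (a : ℕ → ℝ) : Prop :=
  ∀ r : ℝ, 0 ≤ r → r < 1 → Summable fun k => |a k| * r ^ k

/-- Coefficients of the formal derivative of `∑ a k * z ^ k`. -/
def derivCoeff (a : ℕ → ℝ) (k : ℕ) : ℝ := (k + 1) * a (k + 1)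

/-- The sum of the power series with coefficients `a`. -/
noncomputable def powerSum (a : ℕ → ℝ) (z : ℝ) : ℝ := ∑' k, a k * z ^ k

namespace UnitDiscSummable

variable {a : ℕ → ℝ}

lemma natCast_mul (h : UnitDiscSummable a) : UnitDiscSummable fun k => k * a k := by
  intro r hr0 hr1
  obtain ⟨R, hlt, hR1⟩ := exists_between hr1
  have hR0 : 0 < R := hr0.trans_lt hlt
  have hrR : r / R < 1 := (div_lt_one hR0).2 hlt
  have hrR0 : 0 ≤ r / R := by positivity
  obtain ⟨C, hC⟩ := (h R hR0.le hR1).tendsto_atTop_zero.bddAbove_range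
  have hs := summable_pow_mul_geometric_of_norm_lt_one (R := ℝ) 1 (r := r / R)
    (by rwa [Real.norm_of_nonneg hrR0])
  refine Summable.of_nonneg_of_le (fun k => by positivity) (fun k => ?_) (hs.mul_left C)
  have hk : |a k| * R ^ k ≤ C := hC ⟨k, rfl⟩
  calc |(k : ℝ) * a k| * r ^ k = (|a k| * R ^ k) * ((k : ℝ) ^ 1 * (r / R) ^ k) := by
        rw [abs_mul, Nat.abs_cast, div_pow]; field_simp
    _ ≤ C * ((k : ℝ) ^ 1 * (r / R) ^ k) := by gcongr

lemma derivCoeff (h : UnitDiscSummable a) : UnitDiscSummable (derivCoeff a) := by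
  intro r hr0 hr1
  obtain ⟨R, hlt, hR1⟩ := exists_between hr1
  have hR0 : 0 < R := hr0.trans_lt hlt
  have hs := (summable_nat_add_iff 1).2 (h.natCast_mul R hR0.le hR1)
  refine Summable.of_nonneg_of_le (fun k => by positivity) (fun k => ?_) (hs.mul_left R⁻¹)
  have hk : r ^ k ≤ R ^ k := by gcongr
  calc |_root_.derivCoeff a k| * r ^ k ≤ |_root_.derivCoeff a k| * R ^ k := by gcongr
    _ = R⁻¹ * (|((k + 1 : ℕ) : ℝ) * a (k + 1)| * R ^ (k + 1)) := by
        rw [_root_.derivCoeff, pow_succ]; push_cast; field_simp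

lemma summable (h : UnitDiscSummable a) {z : ℝ} (hz : |z| < 1) :
    Summable fun k => a k * z ^ k := by
  refine Summable.of_norm ?_
  simpa [abs_mul, abs_pow] using h |z| (abs_nonneg z) hz

lemma hasDerivAt (h : UnitDiscSummable a) {z : ℝ} (hz : |z| < 1) :
    HasDerivAt (powerSum a) (powerSum (_root_.derivCoeff a) z) z := by
  obtain ⟨r, hzr, hr1⟩ := exists_between hz
  have hr0 : 0 < r := (abs_nonneg z).trans_lt hzr
  have hball : ∀ x ∈ Metric.ball (0 : ℝ) r, |x| < r := fun x hx => by simpa using hx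
  have hs : Summable fun k : ℕ => |(k : ℝ) * a k| * r ^ (k - 1) := by
    rw [← summable_nat_add_iff 1]
    simpa [_root_.derivCoeff] using h.derivCoeff r hr0.le hr1
  have key := hasDerivAt_tsum_of_isPreconnected (g := fun k x => a k * x ^ k)
    (g' := fun k x => a k * (k * x ^ (k - 1))) hs Metric.isOpen_ball
    (convex_ball (0 : ℝ) r).isPreconnected
    (fun k x _ => (hasDerivAt_pow k x).const_mul (a k))
    (fun k x hx => by
      have : |x| ^ (k - 1) ≤ r ^ (k - 1) := by gcongr; exact (hball x hx).le
      calc ‖a k * (k * x ^ (k - 1))‖ = |(k : ℝ) * a k| * |x| ^ (k - 1) := by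
            rw [Real.norm_eq_abs, abs_mul, abs_mul, abs_mul, abs_pow]; ring
        _ ≤ _ := by gcongr)
    (Metric.mem_ball_self hr0) (h.summable (by simp)) (y := z) (by simpa using hzr)
  refine key.congr_deriv ?_
  have hs' : Summable fun k : ℕ => a k * (k * z ^ (k - 1)) := by
    rw [← summable_nat_add_iff 1]
    refine (h.derivCoeff.summable hz).congr fun k => ?_
    simp [_root_.derivCoeff]; ring
  rw [hs'.tsum_eq_zero_add, powerSum]
  simp only [Nat.cast_zero, zero_mul, mul_zero, zero_add]
  refine tsum_congr fun k => ?_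
  simp [_root_.derivCoeff]; ring

lemma mul_powerSum_derivCoeff (h : UnitDiscSummable a) {z : ℝ} (hz : |z| < 1) :
    HasSum (fun k : ℕ => k * a k * z ^ k) (z * powerSum (_root_.derivCoeff a) z) := by
  have h1 := ((h.derivCoeff.summable hz).hasSum).mul_left z
  refine (hasSum_nat_add_iff' 1).1 ?_
  simp only [Finset.range_one, Finset.sum_singleton, Nat.cast_zero, zero_mul, sub_zero]
  refine h1.congr_fun fun k => ?_
  simp only [_root_.derivCoeff]; push_cast; ring

end UnitDiscSummable

/-- Coefficients of `₂F₁(y+1, y+1; 2; z)`. -/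
noncomputable def gaussCoeff (y : ℝ) (k : ℕ) : ℝ :=
  ((ascPochhammer ℝ k).eval (y + 1)) ^ 2 / ((k.factorial : ℝ) * ((k + 1).factorial : ℝ))

lemma gaussCoeff_nonneg (y : ℝ) (k : ℕ) : 0 ≤ gaussCoeff y k := by
  unfold gaussCoeff; positivity

lemma gaussCoeff_zero (y : ℝ) : gaussCoeff y 0 = 1 := by simp [gaussCoeff]

lemma gaussCoeff_succ (y : ℝ) (k : ℕ) :
    ((k : ℝ) + 1) * (k + 2) * gaussCoeff y (k + 1) = (y + 1 + k) ^ 2 * gaussCoeff y k := by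
  have h1 : (k.factorial : ℝ) ≠ 0 := by positivity
  simp only [gaussCoeff, ascPochhammer_succ_eval, Nat.factorial_succ]
  push_cast
  field_simp
  ring

lemma unitDiscSummable_gaussCoeff (y : ℝ) : UnitDiscSummable (gaussCoeff y) := by
  intro r hr0 hr1
  obtain ⟨R, hrR, hR1⟩ := exists_between hr1
  have hlim : Filter.Tendsto (fun k : ℕ => (y + 1 + k) ^ 2 / (((k : ℝ) + 1) * (k + 2)) * r)
      Filter.atTop (nhds (1 * r)) := by
    refine Filter.Tendsto.mul_const r ?_
    have e := (tendsto_add_mul_div_add_mul_atTop_nhds (y + 1) 1 (1 : ℝ) one_ne_zero).mul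
      (tendsto_add_mul_div_add_mul_atTop_nhds (y + 1) 2 (1 : ℝ) one_ne_zero)
    simp only [one_mul, div_one, mul_one] at e
    refine e.congr fun k => ?_
    rw [div_mul_div_comm, add_comm (1 : ℝ), add_comm (2 : ℝ), sq]
  rw [one_mul] at hlim
  refine summable_of_ratio_norm_eventually_le hR1 ?_
  filter_upwards [hlim.eventually_lt_const hrR] with k hk
  have hpos : (0 : ℝ) < ((k : ℝ) + 1) * (k + 2) := by positivity
  have hs : gaussCoeff y (k + 1) =
      (y + 1 + k) ^ 2 / (((k : ℝ) + 1) * (k + 2)) * gaussCoeff y k := by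
    rw [div_mul_eq_mul_div, eq_div_iff hpos.ne', ← gaussCoeff_succ]; ring
  have hn : 0 ≤ gaussCoeff y k * r ^ k := mul_nonneg (gaussCoeff_nonneg y k) (by positivity)
  have hn' : 0 ≤ gaussCoeff y (k + 1) * r ^ (k + 1) :=
    mul_nonneg (gaussCoeff_nonneg y _) (by positivity)
  rw [abs_of_nonneg (gaussCoeff_nonneg y k), abs_of_nonneg (gaussCoeff_nonneg y _),
    Real.norm_of_nonneg hn, Real.norm_of_nonneg hn', hs, pow_succ]
  calc _ = (y + 1 + k) ^ 2 / (((k : ℝ) + 1) * (k + 2)) * r * (gaussCoeff y k * r ^ k) := by ring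
    _ ≤ R * (gaussCoeff y k * r ^ k) := by gcongr

lemma Sgauss_eq_powerSum (y t : ℝ) : Sgauss y t = powerSum (gaussCoeff y) (1 - t) := by
  refine tsum_congr fun k => ?_
  rw [gaussCoeff]; ring

lemma powerSum_gaussCoeff_pos (y : ℝ) {z : ℝ} (hz0 : 0 ≤ z) (hz1 : z < 1) :
    0 < powerSum (gaussCoeff y) z :=
  ((unitDiscSummable_gaussCoeff y).summable (by rwa [abs_of_nonneg hz0])).tsum_pos
    (fun k => mul_nonneg (gaussCoeff_nonneg y k) (by positivity)) 0 (by simp [gaussCoeff_zero])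

lemma powerSum_zero (a : ℕ → ℝ) : powerSum a 0 = a 0 := by
  rw [powerSum, tsum_eq_single 0 fun k hk => by simp [hk]]; simp

/-- The hypergeometric differential equation for `₂F₁(y+1, y+1; 2; z)`. -/
lemma powerSum_gaussCoeff_ode (y : ℝ) {z : ℝ} (hz : |z| < 1) :
    z * (1 - z) * powerSum (derivCoeff (derivCoeff (gaussCoeff y))) z
      + (2 - (2 * y + 3) * z) * powerSum (derivCoeff (gaussCoeff y)) z
      - (y + 1) ^ 2 * powerSum (gaussCoeff y) z = 0 := by
  have h := unitDiscSummable_gaussCoeff y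
  have h0 : HasSum (fun k => gaussCoeff y k * z ^ k) (powerSum (gaussCoeff y) z) :=
    (h.summable hz).hasSum
  have h1 : HasSum (fun k => derivCoeff (gaussCoeff y) k * z ^ k)
      (powerSum (derivCoeff (gaussCoeff y)) z) := (h.derivCoeff.summable hz).hasSum
  have hz1 := h.mul_powerSum_derivCoeff hz
  have hz2 := h.derivCoeff.mul_powerSum_derivCoeff hz
  have hdd : HasSum (fun k : ℕ => (k : ℝ) * (k * gaussCoeff y k) * z ^ k)
      (z * (powerSum (derivCoeff (gaussCoeff y)) z
        + z * powerSum (derivCoeff (derivCoeff (gaussCoeff y))) z)) := by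
    have := (h1.add hz2).mul_left z
    refine (hasSum_nat_add_iff' 1).1 ?_
    simp only [Finset.range_one, Finset.sum_singleton, Nat.cast_zero, zero_mul, sub_zero]
    refine this.congr_fun fun k => ?_
    simp only [derivCoeff]; push_cast; ring
  have hl := hz2.add (h1.mul_left 2)
  have hr := (hdd.add (hz1.mul_left (2 * (y + 1)))).add (h0.mul_left ((y + 1) ^ 2))
  have he := hl.unique (hr.congr_fun fun k => by
    simp only [derivCoeff]
    linear_combination z ^ k * gaussCoeff_succ y k)
  linear_combination he

/-- Sturm-type comparison for solutions of `(1 - z) * ((1 - z) * (z * u)')' = μ * u` that are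
positive and normalized by `u 0 = 1`. -/
lemma le_of_ode_comparison {u₁ u₂ v₁ v₂ : ℝ → ℝ} {μ₁ μ₂ : ℝ} (hμ : μ₁ ≤ μ₂)
    (hu₁ : ∀ z, 0 ≤ z → z < 1 → HasDerivAt u₁ (v₁ z) z)
    (hu₂ : ∀ z, 0 ≤ z → z < 1 → HasDerivAt u₂ (v₂ z) z)
    (hP₁ : ∀ z, 0 ≤ z → z < 1 →
      HasDerivAt (fun x => (1 - x) * (u₁ x + x * v₁ x)) (μ₁ * u₁ z / (1 - z)) z)
    (hP₂ : ∀ z, 0 ≤ z → z < 1 →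
      HasDerivAt (fun x => (1 - x) * (u₂ x + x * v₂ x)) (μ₂ * u₂ z / (1 - z)) z)
    (hpos₁ : ∀ z, 0 ≤ z → z < 1 → 0 < u₁ z) (hpos₂ : ∀ z, 0 ≤ z → z < 1 → 0 < u₂ z)
    (h₁ : u₁ 0 = 1) (h₂ : u₂ 0 = 1) {z : ℝ} (hz0 : 0 ≤ z) (hz1 : z < 1) :
    u₁ z ≤ u₂ z := by
  have hW : ∀ x, 0 ≤ x → x < 1 → HasDerivAt
      (fun x => x * u₁ x * ((1 - x) * (u₂ x + x * v₂ x))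
        - x * u₂ x * ((1 - x) * (u₁ x + x * v₁ x)))
      ((μ₂ - μ₁) * (x * u₁ x * u₂ x / (1 - x))) x := by
    intro x hx0 hx1
    have := (((hasDerivAt_id x).mul (hu₁ x hx0 hx1)).mul (hP₂ x hx0 hx1)).sub
      (((hasDerivAt_id x).mul (hu₂ x hx0 hx1)).mul (hP₁ x hx0 hx1))
    refine this.congr_deriv ?_
    simp only [id, Pi.mul_apply]
    ring
  have hWmono : MonotoneOn (fun x => x * u₁ x * ((1 - x) * (u₂ x + x * v₂ x))
        - x * u₂ x * ((1 - x) * (u₁ x + x * v₁ x))) (Ico 0 1) := by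
    refine monotoneOn_of_hasDerivWithinAt_nonneg (convex_Ico 0 1)
      (fun x hx => (hW x hx.1 hx.2).continuousAt.continuousWithinAt)
      (fun x hx => (hW x (interior_subset hx).1 (interior_subset hx).2).hasDerivWithinAt)
      fun x hx => ?_
    have hx' := interior_subset hx
    have a1 := hpos₁ x hx'.1 hx'.2
    have a2 := hpos₂ x hx'.1 hx'.2
    have a3 := sub_pos.2 hx'.2
    have a4 := sub_nonneg.2 hμ
    have a5 := hx'.1
    positivity
  have hq : ∀ x, 0 ≤ x → x < 1 → HasDerivAt (fun x => u₂ x / u₁ x)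
      ((v₂ x * u₁ x - u₂ x * v₁ x) / u₁ x ^ 2) x := fun x hx0 hx1 =>
    (hu₂ x hx0 hx1).div (hu₁ x hx0 hx1) (hpos₁ x hx0 hx1).ne'
  have hqmono : MonotoneOn (fun x => u₂ x / u₁ x) (Ico 0 1) := by
    refine monotoneOn_of_hasDerivWithinAt_nonneg (convex_Ico 0 1)
      (fun x hx => (hq x hx.1 hx.2).continuousAt.continuousWithinAt)
      (fun x hx => (hq x (interior_subset hx).1 (interior_subset hx).2).hasDerivWithinAt)
      fun x hx => ?_
    rw [interior_Ico] at hx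
    have hw := hWmono (⟨le_rfl, one_pos⟩ : (0 : ℝ) ∈ Ico (0 : ℝ) 1) ⟨hx.1.le, hx.2⟩ hx.1.le
    have hc : 0 < x ^ 2 * (1 - x) := mul_pos (pow_pos hx.1 2) (sub_pos.2 hx.2)
    have hw' : 0 ≤ (x ^ 2 * (1 - x)) * (v₂ x * u₁ x - u₂ x * v₁ x) := by
      simp only [zero_mul, sub_self] at hw
      linarith
    exact div_nonneg (nonneg_of_mul_nonneg_right hw' hc) (sq_nonneg _)
  have := hqmono (⟨le_rfl, one_pos⟩ : (0 : ℝ) ∈ Ico (0 : ℝ) 1) ⟨hz0, hz1⟩ hz0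
  simp only [h₁, h₂, div_one] at this
  rwa [one_le_div (hpos₁ z hz0 hz1)] at this

lemma hasDerivAt_one_sub_rpow (y : ℝ) {z : ℝ} (hz1 : z < 1) :
    HasDerivAt (fun x : ℝ => (1 - x) ^ y) (-y * (1 - z) ^ y / (1 - z)) z := by
  have hz : 0 < 1 - z := sub_pos.2 hz1
  refine (((hasDerivAt_id z).const_sub 1).rpow_const (p := y) (Or.inl hz.ne')).congr_deriv ?_
  rw [id, Real.rpow_sub_one hz.ne']
  ring

lemma hasDerivAt_rpow_mul_powerSum (y : ℝ) {z : ℝ} (hz0 : 0 ≤ z) (hz1 : z < 1) :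
    HasDerivAt (fun x => (1 - x) ^ y * powerSum (gaussCoeff y) x)
      ((1 - z) ^ y * (powerSum (derivCoeff (gaussCoeff y)) z
        - y * powerSum (gaussCoeff y) z / (1 - z))) z := by
  refine ((hasDerivAt_one_sub_rpow y hz1).mul ((unitDiscSummable_gaussCoeff y).hasDerivAt
    (by rwa [abs_of_nonneg hz0]))).congr_deriv ?_
  ring

lemma rpow_mul_powerSum_ode (y : ℝ) {z : ℝ} (hz0 : 0 ≤ z) (hz1 : z < 1) :
    HasDerivAt (fun x => (1 - x) * ((1 - x) ^ y * powerSum (gaussCoeff y) x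
        + x * ((1 - x) ^ y * (powerSum (derivCoeff (gaussCoeff y)) x
          - y * powerSum (gaussCoeff y) x / (1 - x)))))
      (y ^ 2 * ((1 - z) ^ y * powerSum (gaussCoeff y) z) / (1 - z)) z := by
  have hz : |z| < 1 := by rwa [abs_of_nonneg hz0]
  have hne : 1 - z ≠ 0 := (sub_pos.2 hz1).ne'
  have h := unitDiscSummable_gaussCoeff y
  have hF := h.hasDerivAt hz
  have hF' := h.derivCoeff.hasDerivAt hz
  have hid := hasDerivAt_id z
  have key := (hasDerivAt_one_sub_rpow y hz1).mul
    (((hid.const_sub 1).mul (hF.add (hid.mul hF'))).sub ((hid.mul hF).const_mul y))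
  refine (key.congr_of_eventuallyEq ?_).congr_deriv ?_
  · filter_upwards [gt_mem_nhds hz1] with x hx
    have : 1 - x ≠ 0 := (sub_pos.2 hx).ne'
    simp only [Pi.mul_apply, Pi.add_apply, Pi.sub_apply, id]
    field_simp
    ring
  · simp only [Pi.mul_apply, Pi.add_apply, Pi.sub_apply, id]
    rw [eq_div_iff hne, div_mul_eq_mul_div, add_mul, div_mul_cancel₀ _ hne]
    linear_combination (1 - z) ^ y * (1 - z) * powerSum_gaussCoeff_ode y hz

lemma rpow_mul_Sgauss_le {t : ℝ} (ht : 0 < t) (ht1 : t < 1) {y₁ y₂ : ℝ}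
    (hy : y₁ ^ 2 ≤ y₂ ^ 2) : t ^ y₁ * Sgauss y₁ t ≤ t ^ y₂ * Sgauss y₂ t := by
  have key := le_of_ode_comparison hy
    (fun z => hasDerivAt_rpow_mul_powerSum y₁) (fun z => hasDerivAt_rpow_mul_powerSum y₂)
    (fun z => rpow_mul_powerSum_ode y₁) (fun z => rpow_mul_powerSum_ode y₂)
    (fun z h0 h1 => mul_pos (rpow_pos_of_pos (sub_pos.2 h1) _) (powerSum_gaussCoeff_pos y₁ h0 h1))
    (fun z h0 h1 => mul_pos (rpow_pos_of_pos (sub_pos.2 h1) _) (powerSum_gaussCoeff_pos y₂ h0 h1))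
    (by simp [powerSum_zero, gaussCoeff_zero]) (by simp [powerSum_zero, gaussCoeff_zero])
    (z := 1 - t) (by linarith) (by linarith)
  simpa only [Sgauss_eq_powerSum, sub_sub_cancel] using key

lemma fPol_lt {t : ℝ} (ht : 0 < t) (ht1 : t < 1) {y₁ y₂ : ℝ} (hy : y₁ ^ 2 < y₂ ^ 2) :
    fPol t y₁ < fPol t y₂ := by
  have h₂ : 0 < t ^ y₂ * Sgauss y₂ t := by
    rw [Sgauss_eq_powerSum]
    exact mul_pos (rpow_pos_of_pos ht _) (powerSum_gaussCoeff_pos y₂ (by linarith) (by linarith))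
  rw [fPol, fPol, mul_assoc, mul_assoc]
  calc y₁ ^ 2 * (t ^ y₁ * Sgauss y₁ t) ≤ y₁ ^ 2 * (t ^ y₂ * Sgauss y₂ t) :=
        mul_le_mul_of_nonneg_left (rpow_mul_Sgauss_le ht ht1 hy.le) (sq_nonneg _)
    _ < y₂ ^ 2 * (t ^ y₂ * Sgauss y₂ t) := mul_lt_mul_of_pos_right hy h₂

lemma fPol_neg {t : ℝ} (ht : 0 < t) (ht1 : t < 1) (y : ℝ) : fPol t (-y) = fPol t y := by
  have hy : (-y) ^ 2 = y ^ 2 := neg_sq y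
  rw [fPol, fPol, mul_assoc, mul_assoc, hy,
    le_antisymm (rpow_mul_Sgauss_le ht ht1 hy.le) (rpow_mul_Sgauss_le ht ht1 hy.ge)]

/-- sign of `f_t(y+c) − f_t(y−c)` according to the sign of `y`. -/
theorem fPol_diff_sign (t c : ℝ) (ht : 0 < t) (ht1 : t < 1) (hc : 0 < c) (y : ℝ) :
    (0 < y → 0 < fPol t (y + c) - fPol t (y - c)) ∧
    (y = 0 → fPol t (y + c) - fPol t (y - c) = 0) ∧
    (y < 0 → fPol t (y + c) - fPol t (y - c) < 0) := by
  refine ⟨fun hy => sub_pos.2 (fPol_lt ht ht1 ?_), fun hy => ?_,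
    fun hy => sub_neg.2 (fPol_lt ht ht1 ?_)⟩
  · nlinarith [mul_pos hy hc]
  · rw [hy, zero_add, zero_sub, fPol_neg ht ht1, sub_self]
  · nlinarith [mul_pos_of_neg_of_neg hy (neg_lt_zero.2 hc)]
end
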